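/- arXiv:2502.04662 — 4 statements merged into one kernel-verified Lean document; each statement's English description precedes it below -/
import Mathlib

section
/- (Adversarial perturbation bound for the Robust-TD reward estimate.) Suppose the Markov chain (s_t) induced by the policy is irreducible and aperiodic and is started from its stationary distribution π, suppose ε ≤ 1/192, and suppose the burn-in time satisfies T̄ = ⌈c₁ τ_mix log²(KT)⌉ for a sufficiently large universal constant c₁. Then there exists a universal constant c > 0 such that for all t with T̄ ≤ t ≤ T, the Robust-TD estimate b̂_t satisfies E[ ‖b̂_t − b̄‖₂² ] ≤ c ( ε + log²(KT) τ_mix / t ) K σ₁², where σ₁ = max{1, r̄, ρ} and b̄ = ∑_{s∈S} π(s) φ(s) R(s). -/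
open Matrix MeasureTheory

/-- `med` is a median of the `L` values `vals 0, …, vals (L−1)`. -/
def IsMedianOf (L : ℕ) (vals : ℕ → ℝ) (med : ℝ) : Prop :=
  L ≤ 2 * ((Finset.range L).filter fun i => vals i ≤ med).card ∧
    L ≤ 2 * ((Finset.range L).filter fun i => med ≤ vals i).card

/-- The mixing quantity `d_mix(t)` of a finite-state chain `(P, π)`. -/
noncomputable def dmixMat {𝒳 : Type*} [Fintype 𝒳] [DecidableEq 𝒳]
    (P : Matrix 𝒳 𝒳 ℝ) (π : 𝒳 → ℝ) (t : ℕ) : ℝ :=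
  ⨆ x, (1 / 2) * ∑ y, |(P ^ t) x y - π y|

/-- The mixing time `τ_mix = inf{t ≥ 1 : d_mix(t) ≤ 1/4}`. -/
noncomputable def tmixMat {𝒳 : Type*} [Fintype 𝒳] [DecidableEq 𝒳]
    (P : Matrix 𝒳 𝒳 ℝ) (π : 𝒳 → ℝ) : ℕ :=
  sInf {t | 1 ≤ t ∧ dmixMat P π t ≤ 1 / 4}

/-- Mean of the `i`-th bucket (of size `M`) of the data `y` subsampled at gap `τ`. -/
noncomputable def subsampledBucketMean (τ M : ℕ) (y : ℕ → ℝ) (i : ℕ) : ℝ :=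
  (∑ j ∈ Finset.range M, y ((i * M + j) * τ)) / M

/-- RUMEM subsampling gap `τ = ⌈log₂(6N/δ) τ_mix⌉`. -/
noncomputable def rumemTau (tmix N : ℕ) (δ : ℝ) : ℕ :=
  ⌈Real.logb 2 (6 * N / δ) * (tmix : ℝ)⌉₊

/-- RUMEM subsample size `n = ⌊(N−1)/τ⌋ + 1`. -/
noncomputable def rumemn (tmix N : ℕ) (δ : ℝ) : ℕ :=
  (N - 1) / rumemTau tmix N δ + 1

/-- RUMEM effective corruption level `ε′ = ε + (32/(3n)) log(24/δ)`. -/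
noncomputable def rumemEps' (tmix N : ℕ) (δ ε : ℝ) : ℝ :=
  ε + 32 / (3 * (rumemn tmix N δ : ℝ)) * Real.log (24 / δ)

/-- RUMEM number of buckets `L = ⌈12ε′n + (256/7) log(N/δ)⌉`. -/
noncomputable def rumemL (tmix N : ℕ) (δ ε : ℝ) : ℕ :=
  ⌈12 * rumemEps' tmix N δ ε * (rumemn tmix N δ : ℝ) + (256 / 7) * Real.log (N / δ)⌉₊

/-- `out` is an output of the RUMEM estimator (with mixing time `tmix`, sample
size `N`, confidence `δ`, corruption level `ε`) on the data `y 0, …, y (N−1)`: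
a median of the bucket means of the subsampled data. -/
def IsRumemOutput (tmix N : ℕ) (δ ε : ℝ) (y : ℕ → ℝ) (out : ℝ) : Prop :=
  IsMedianOf (rumemL tmix N δ ε)
    (subsampledBucketMean (rumemTau tmix N δ) (rumemn tmix N δ / rumemL tmix N δ ε) y) out

/-- The squared Euclidean norm of a vector in `ℝ^K`. -/
def sqNorm {K : ℕ} (v : Fin K → ℝ) : ℝ := v ⬝ᵥ v

section Mixing

variable {𝒳 : Type*} [Fintype 𝒳]

/-- If every row of `A` is within `θ` of a common vector `w` in `ℓ¹`, then `A` contracts zero-sum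
row vectors by the factor `θ`. -/
theorem sum_abs_vecMul_le {A : Matrix 𝒳 𝒳 ℝ} {w : 𝒳 → ℝ} {θ : ℝ}
    (hA : ∀ x, ∑ y, |A x y - w y| ≤ θ) {u : 𝒳 → ℝ} (hu : ∑ x, u x = 0) :
    ∑ y, |(u ᵥ* A) y| ≤ θ * ∑ x, |u x| := by
  have h1 : ∀ y, (u ᵥ* A) y = ∑ x, u x * (A x y - w y) := by
    intro y
    simp only [mul_sub, Finset.sum_sub_distrib, ← Finset.sum_mul, hu, zero_mul, sub_zero]
    rfl
  calc ∑ y, |(u ᵥ* A) y| ≤ ∑ y, ∑ x, |u x| * |A x y - w y| := by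
        refine Finset.sum_le_sum fun y _ => ?_
        rw [h1]
        refine (Finset.abs_sum_le_sum_abs _ _).trans_eq ?_
        simp only [abs_mul]
    _ = ∑ x, |u x| * ∑ y, |A x y - w y| := by
        rw [Finset.sum_comm]
        simp only [Finset.mul_sum]
    _ ≤ ∑ x, |u x| * θ :=
        Finset.sum_le_sum fun x _ => mul_le_mul_of_nonneg_left (hA x) (abs_nonneg _)
    _ = θ * ∑ x, |u x| := by rw [← Finset.sum_mul, mul_comm]

variable [DecidableEq 𝒳]

theorem sum_vecMul_of_mem_rowStochastic {A : Matrix 𝒳 𝒳 ℝ} (hA : A ∈ rowStochastic ℝ 𝒳)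
    (u : 𝒳 → ℝ) : ∑ y, (u ᵥ* A) y = ∑ x, u x := by
  simp only [Matrix.vecMul, dotProduct]
  rw [Finset.sum_comm]
  simp only [← Finset.mul_sum, sum_row_of_mem_rowStochastic hA, mul_one]

theorem sum_abs_vecMul_pow_le {A : Matrix 𝒳 𝒳 ℝ} (hA : A ∈ rowStochastic ℝ 𝒳) {w : 𝒳 → ℝ} {θ : ℝ}
    (hθ : 0 ≤ θ) (hw : ∀ x, ∑ y, |A x y - w y| ≤ θ) {u : 𝒳 → ℝ} (hu : ∑ x, u x = 0) (k : ℕ) :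
    ∑ y, |(u ᵥ* A ^ k) y| ≤ θ ^ k * ∑ x, |u x| := by
  induction k with
  | zero => simp
  | succ k ih =>
    rw [pow_succ, ← Matrix.vecMul_vecMul]
    have h0 : ∑ y, (u ᵥ* A ^ k) y = 0 := by
      rw [sum_vecMul_of_mem_rowStochastic (pow_mem hA k), hu]
    refine (sum_abs_vecMul_le hw h0).trans ?_
    rw [pow_succ', mul_assoc]
    exact mul_le_mul_of_nonneg_left ih hθ

theorem vecMul_pow_eq_self {P : Matrix 𝒳 𝒳 ℝ} {π : 𝒳 → ℝ} (hπ : π ᵥ* P = π) (t : ℕ) :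
    π ᵥ* P ^ t = π := by
  induction t with
  | zero => simp
  | succ k ih => rw [pow_succ, ← Matrix.vecMul_vecMul, ih, hπ]

theorem pow_row_sub_stationary {P : Matrix 𝒳 𝒳 ℝ} {π : 𝒳 → ℝ} (hπ : π ᵥ* P = π) (t : ℕ)
    (x y : 𝒳) : (P ^ t) x y - π y = ((Pi.single x 1 - π) ᵥ* P ^ t) y := by
  rw [Matrix.sub_vecMul, vecMul_pow_eq_self hπ, Matrix.single_one_vecMul]
  rfl

theorem sum_abs_single_sub_le {π : 𝒳 → ℝ} (h0 : ∀ x, 0 ≤ π x) (h1 : ∑ x, π x = 1) (x : 𝒳) :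
    ∑ y, |(Pi.single x 1 - π : 𝒳 → ℝ) y| ≤ 2 := by
  have : ∀ y, |(Pi.single x 1 - π : 𝒳 → ℝ) y| ≤ (Pi.single x 1 : 𝒳 → ℝ) y + π y := by
    intro y
    rw [Pi.sub_apply]
    have hs : 0 ≤ (Pi.single x 1 : 𝒳 → ℝ) y := by
      rw [Pi.single_apply]; split_ifs <;> norm_num
    rw [abs_le]
    constructor <;> linarith [h0 y]
  refine (Finset.sum_le_sum fun y _ => this y).trans ?_
  rw [Finset.sum_add_distrib, h1, Finset.sum_pi_single']
  norm_num

theorem sum_single_sub {π : 𝒳 → ℝ} (h1 : ∑ x, π x = 1) (x : 𝒳) :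
    ∑ y, (Pi.single x 1 - π : 𝒳 → ℝ) y = 0 := by
  simp [h1]

theorem sum_abs_pow_sub_le_of_dmixMat_le {P : Matrix 𝒳 𝒳 ℝ} {π : 𝒳 → ℝ} {t : ℕ} {d : ℝ}
    (h : dmixMat P π t ≤ d) (x : 𝒳) : ∑ y, |(P ^ t) x y - π y| ≤ 2 * d := by
  have := (le_ciSup (f := fun x => (1 / 2 : ℝ) * ∑ y, |(P ^ t) x y - π y|)
    (Set.finite_range _).bddAbove x).trans h
  linarith

/-- A primitive stochastic matrix mixes: its mixing time is attained. -/
theorem exists_dmixMat_le [Nonempty 𝒳] {P : Matrix 𝒳 𝒳 ℝ} (hP : P ∈ rowStochastic ℝ 𝒳)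
    (hprim : ∃ k : ℕ, ∀ x y, 0 < (P ^ k) x y) {π : 𝒳 → ℝ} (h0 : ∀ x, 0 < π x)
    (h1 : ∑ x, π x = 1) (hπ : π ᵥ* P = π) {d : ℝ} (hd : 0 < d) :
    ∃ t, 1 ≤ t ∧ dmixMat P π t ≤ d := by
  obtain ⟨k, hk⟩ := hprim
  have hA : ∀ x y, 0 < (P ^ (k + 1)) x y := by
    intro x y
    rw [pow_succ', Matrix.mul_apply]
    have hx : ∃ z ∈ Finset.univ, 0 < P x z := by
      by_contra! hcon
      have := sum_row_of_mem_rowStochastic hP x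
      have := Finset.sum_nonpos hcon
      linarith
    obtain ⟨z, -, hz⟩ := hx
    exact Finset.sum_pos' (fun z _ => mul_nonneg (nonneg_of_mem_rowStochastic hP) (hk z y).le)
      ⟨z, Finset.mem_univ _, mul_pos hz (hk z y)⟩
  set A := P ^ (k + 1) with hAdef
  have hAs : A ∈ rowStochastic ℝ 𝒳 := pow_mem hP _
  obtain ⟨q, hq⟩ := Finite.exists_min fun q : 𝒳 × 𝒳 => A q.1 q.2
  set α := A q.1 q.2 with hα
  have hα0 : 0 < α := hA _ _
  have hπ1 : ∀ y, π y ≤ 1 := fun y =>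
    h1 ▸ Finset.single_le_sum (f := π) (fun z _ => (h0 z).le) (Finset.mem_univ y)
  have hdom : ∀ x y, α * π y ≤ A x y := fun x y =>
    (mul_le_of_le_one_right hα0.le (hπ1 y)).trans (hq (x, y))
  have hcontr : ∀ x, ∑ y, |A x y - α * π y| = 1 - α := by
    intro x
    rw [Finset.sum_congr rfl fun y _ => abs_of_nonneg (sub_nonneg.2 (hdom x y)),
      Finset.sum_sub_distrib, ← Finset.mul_sum, h1, sum_row_of_mem_rowStochastic hAs, mul_one]
  have hα1 : 0 ≤ 1 - α := by
    obtain ⟨x⟩ := ‹Nonempty 𝒳›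
    rw [← hcontr x]
    positivity
  obtain ⟨j, hj⟩ := exists_pow_lt_of_lt_one hd (by linarith : 1 - α < 1)
  refine ⟨(k + 1) * (j + 1), Nat.succ_le_of_lt (by positivity), ciSup_le fun x => ?_⟩
  have hb := sum_abs_vecMul_pow_le hAs hα1 (fun x => (hcontr x).le) (sum_single_sub h1 x) (j + 1)
  have hs := sum_abs_single_sub_le (fun x => (h0 x).le) h1 x
  have hpow : (1 - α) ^ (j + 1) ≤ d := by
    refine le_trans ?_ hj.le
    exact pow_le_pow_of_le_one hα1 (by linarith) (Nat.le_succ j)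
  simp only [pow_row_sub_stationary hπ]
  rw [pow_mul]
  have h3 := mul_le_mul hpow hs (by positivity) hd.le
  linarith [hb.trans h3]

theorem tmixMat_spec [Nonempty 𝒳] {P : Matrix 𝒳 𝒳 ℝ} (hP : P ∈ rowStochastic ℝ 𝒳)
    (hprim : ∃ k : ℕ, ∀ x y, 0 < (P ^ k) x y) {π : 𝒳 → ℝ} (h0 : ∀ x, 0 < π x)
    (h1 : ∑ x, π x = 1) (hπ : π ᵥ* P = π) :
    1 ≤ tmixMat P π ∧ dmixMat P π (tmixMat P π) ≤ 1 / 4 :=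
  Nat.sInf_mem (exists_dmixMat_le hP hprim h0 h1 hπ (by norm_num : (0 : ℝ) < 1 / 4))

/-- After `k` mixing times the `ℓ¹` distance to stationarity is at most `2 ^ (1 - k)`. -/
theorem sum_abs_pow_sub_stationary_le [Nonempty 𝒳] {P : Matrix 𝒳 𝒳 ℝ}
    (hP : P ∈ rowStochastic ℝ 𝒳) (hprim : ∃ k : ℕ, ∀ x y, 0 < (P ^ k) x y) {π : 𝒳 → ℝ}
    (h0 : ∀ x, 0 < π x) (h1 : ∑ x, π x = 1) (hπ : π ᵥ* P = π) {k τ : ℕ}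
    (hk : k * tmixMat P π ≤ τ) (x : 𝒳) :
    ∑ y, |(P ^ τ) x y - π y| ≤ 2 * (1 / 2) ^ k := by
  obtain ⟨j, rfl⟩ := Nat.exists_eq_add_of_le hk
  have hmix := (tmixMat_spec hP hprim h0 h1 hπ).2
  have hA := pow_mem hP (tmixMat P π)
  have hrow : ∀ x, ∑ y, |(P ^ tmixMat P π) x y - π y| ≤ 1 / 2 := fun x => by
    linarith [sum_abs_pow_sub_le_of_dmixMat_le hmix x]
  have hone : ∀ x, ∑ y, |P x y - (0 : 𝒳 → ℝ) y| ≤ 1 := fun x => by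
    simp only [Pi.zero_apply, sub_zero, abs_of_nonneg (nonneg_of_mem_rowStochastic hP),
      sum_row_of_mem_rowStochastic hP, le_refl]
  have hz := sum_single_sub h1 x
  have hb := sum_abs_vecMul_pow_le hA (by norm_num) hrow hz k
  have hz' : ∑ y, ((Pi.single x 1 - π) ᵥ* (P ^ tmixMat P π) ^ k) y = 0 := by
    rw [sum_vecMul_of_mem_rowStochastic (pow_mem hA k), hz]
  have hc := sum_abs_vecMul_pow_le hP zero_le_one hone hz' j
  simp only [pow_row_sub_stationary hπ]
  rw [pow_add, mul_comm k, pow_mul, ← Matrix.vecMul_vecMul]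
  rw [one_pow, one_mul] at hc
  refine hc.trans (hb.trans ?_)
  rw [mul_comm]
  exact mul_le_mul_of_nonneg_right (sum_abs_single_sub_le (fun x => (h0 x).le) h1 x) (by positivity)

end Mixing

section MarkovReward

variable {Ω : Type*} {m : ℕ}

/-- The joint law of a Markov chain `s` with transition matrix `P` and initial law `π`, and of
rewards `r` which, given the chain, are independent with `r k` distributed as `μ k (s k)`. -/
def HasMarkovRewardLaw [MeasurableSpace Ω] (Pr : Measure Ω) (P : Matrix (Fin m) (Fin m) ℝ)
    (π : Fin m → ℝ) (μ : ℕ → Fin m → Measure ℝ) (s : ℕ → Ω → Fin m) (r : ℕ → Ω → ℝ) : Prop :=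
  ∀ (n : ℕ) (f : Fin (n + 1) → Fin m) (B : Fin (n + 1) → Set ℝ), (∀ k, MeasurableSet (B k)) →
    Pr {ω | ∀ k : Fin (n + 1), s k ω = f k ∧ r k ω ∈ B k} =
      ENNReal.ofReal (π (f 0)) *
        (∏ k : Fin n, ENNReal.ofReal (P (f k.castSucc) (f k.succ))) *
        ∏ k : Fin (n + 1), μ k (f k) (B k)

/-- The history of states and rewards up to time `n`. -/
def history (s : ℕ → Ω → Fin m) (r : ℕ → Ω → ℝ) (n : ℕ) (ω : Ω) :
    (Fin (n + 1) → Fin m) × (Fin (n + 1) → ℝ) :=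
  (fun k => s k ω, fun k => r k ω)

/-- The `σ`-algebra of events determined by the history up to time `n`. -/
abbrev historySigma (s : ℕ → Ω → Fin m) (r : ℕ → Ω → ℝ) (n : ℕ) : MeasurableSpace Ω :=
  MeasurableSpace.comap (history s r n) inferInstance

theorem measurable_history_state (s : ℕ → Ω → Fin m) (r : ℕ → Ω → ℝ) {k n : ℕ} (h : k ≤ n) :
    Measurable[historySigma s r n] (s k) :=
  ((measurable_pi_apply (⟨k, Nat.lt_succ_of_le h⟩ : Fin (n + 1))).comp measurable_fst).comp
    (comap_measurable (history s r n))

theorem measurable_history_reward (s : ℕ → Ω → Fin m) (r : ℕ → Ω → ℝ) {k n : ℕ} (h : k ≤ n) :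
    Measurable[historySigma s r n] (r k) :=
  ((measurable_pi_apply (⟨k, Nat.lt_succ_of_le h⟩ : Fin (n + 1))).comp measurable_snd).comp
    (comap_measurable (history s r n))

theorem measurable_history_sum (s : ℕ → Ω → Fin m) (r : ℕ → Ω → ℝ) (φ : Fin m → ℝ) {n M : ℕ}
    {k : ℕ → ℕ} (hk : ∀ i < M, k i ≤ n) :
    Measurable[historySigma s r n]
      fun ω => ∑ i ∈ Finset.range M, φ (s (k i) ω) * r (k i) ω := by
  let _ := historySigma s r n
  refine Finset.measurable_fun_sum _ fun i hi => ?_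
  have hi' := hk i (Finset.mem_range.1 hi)
  exact ((measurable_of_finite φ).comp (measurable_history_state s r hi')).mul
    (measurable_history_reward s r hi')

theorem historySigma_mono (s : ℕ → Ω → Fin m) (r : ℕ → Ω → ℝ) {n n' : ℕ} (h : n ≤ n') :
    historySigma s r n ≤ historySigma s r n' := by
  let _ := historySigma s r n'
  have h1 : Measurable fun (ω : Ω) (k : Fin (n + 1)) => s k ω := measurable_pi_lambda _ fun k =>
    measurable_history_state s r ((Nat.lt_succ_iff.1 k.2).trans h)
  have h2 : Measurable fun (ω : Ω) (k : Fin (n + 1)) => r k ω := measurable_pi_lambda _ fun k =>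
    measurable_history_reward s r ((Nat.lt_succ_iff.1 k.2).trans h)
  have h3 : Measurable (history s r n) := by
    unfold history
    exact h1.prodMk h2
  exact h3.comap_le

variable [MeasurableSpace Ω] {Pr : Measure Ω} {P : Matrix (Fin m) (Fin m) ℝ}
  {π : Fin m → ℝ} {μ : ℕ → Fin m → Measure ℝ} {s : ℕ → Ω → Fin m} {r : ℕ → Ω → ℝ}

theorem measurable_history (hs : ∀ k, Measurable (s k)) (hr : ∀ k, Measurable (r k)) (n : ℕ) :
    Measurable (history s r n) := by
  unfold history
  have h1 : Measurable fun (ω : Ω) (k : Fin (n + 1)) => s k ω :=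
    measurable_pi_lambda _ fun k => hs k
  have h2 : Measurable fun (ω : Ω) (k : Fin (n + 1)) => r k ω :=
    measurable_pi_lambda _ fun k => hr k
  exact h1.prodMk h2

theorem historySigma_le (hs : ∀ k, Measurable (s k)) (hr : ∀ k, Measurable (r k)) (n : ℕ) :
    historySigma s r n ≤ ‹MeasurableSpace Ω› :=
  (measurable_history hs hr n).comap_le

/-- One-step Markov property on a fixed state path. -/
theorem HasMarkovRewardLaw.measure_path [IsProbabilityMeasure Pr]
    (h : HasMarkovRewardLaw Pr P π μ s r)
    (hs : ∀ k, Measurable (s k)) (hr : ∀ k, Measurable (r k))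
    (n : ℕ) (f : Fin (n + 1) → Fin m) (y : Fin m) {C : Set (Fin (n + 1) → ℝ)}
    (hC : MeasurableSet C) {B : Set ℝ} (hB : MeasurableSet B) [∀ k x, IsFiniteMeasure (μ k x)] :
    Pr (((fun ω k => r (k : Fin (n + 1)) ω) ⁻¹' C ∩ {ω | ∀ k : Fin (n + 1), s k ω = f k}) ∩
        {ω | s (n + 1) ω = y ∧ r (n + 1) ω ∈ B}) =
      (ENNReal.ofReal (P (f (Fin.last n)) y) * μ (n + 1) y B) *
      Pr ((fun ω k => r (k : Fin (n + 1)) ω) ⁻¹' C ∩ {ω | ∀ k : Fin (n + 1), s k ω = f k}) := by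
  set ρ : Ω → Fin (n + 1) → ℝ := fun ω k => r (k : Fin (n + 1)) ω with hρ
  have hρm : Measurable ρ := measurable_pi_lambda _ fun k => hr k
  set c := ENNReal.ofReal (P (f (Fin.last n)) y) * μ (n + 1) y B with hc
  have hcfin : c ≠ ⊤ := ENNReal.mul_ne_top ENNReal.ofReal_ne_top (measure_ne_top _ _)
  set D := {ω | ∀ k : Fin (n + 1), s k ω = f k}
  set E := {ω | s (n + 1) ω = y ∧ r (n + 1) ω ∈ B}
  have hD : MeasurableSet D := by
    have : D = ⋂ k : Fin (n + 1), s k ⁻¹' {f k} := by ext; simp [D]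
    rw [this]
    exact MeasurableSet.iInter fun k => hs k (measurableSet_singleton _)
  have hE : MeasurableSet E := (hs _ (measurableSet_singleton y)).inter (hr _ hB)
  have hbox : ∀ S : Fin (n + 1) → Set ℝ, (∀ k, MeasurableSet (S k)) →
      ((Pr.restrict (D ∩ E)).map ρ) (Set.univ.pi S) = (c • (Pr.restrict D).map ρ) (Set.univ.pi S) := by
    intro S hS
    have hSm : MeasurableSet (Set.univ.pi S) := MeasurableSet.univ_pi hS
    rw [Measure.smul_apply, Measure.map_apply hρm hSm, Measure.map_apply hρm hSm,
      Measure.restrict_apply (hρm hSm), Measure.restrict_apply (hρm hSm)]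
    have h1 := h n f S hS
    have h2 := h (n + 1) (Fin.snoc (α := fun _ => Fin m) f y)
      (Fin.snoc (α := fun _ => Set ℝ) S B) (by
        intro k
        refine Fin.lastCases ?_ (fun k => ?_) k
        · simpa using hB
        · simpa using hS k)
    have e1 : ρ ⁻¹' Set.univ.pi S ∩ D = {ω | ∀ k : Fin (n + 1), s k ω = f k ∧ r k ω ∈ S k} := by
      ext ω
      simp only [Set.mem_inter_iff, Set.mem_preimage, Set.mem_pi, Set.mem_univ, true_imp_iff,
        Set.mem_ofPred_eq, forall_and, D, ρ]
      exact and_comm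
    have e2 : ρ ⁻¹' Set.univ.pi S ∩ (D ∩ E) = {ω | ∀ k : Fin (n + 1 + 1),
        s k ω = (Fin.snoc (α := fun _ => Fin m) f y : Fin (n + 1 + 1) → Fin m) k ∧
        r k ω ∈ (Fin.snoc (α := fun _ => Set ℝ) S B : Fin (n + 1 + 1) → Set ℝ) k} := by
      rw [← Set.inter_assoc, e1]
      ext ω
      simp only [Set.mem_inter_iff, Set.mem_ofPred_eq, Fin.forall_fin_succ', Fin.snoc_castSucc,
        Fin.snoc_last, Fin.val_castSucc, Fin.val_last, E]
    rw [e1, e2, h1, h2, Fin.prod_univ_castSucc, Fin.prod_univ_castSucc (n := n + 1)]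
    have h0 : (Fin.snoc (α := fun _ => Fin m) f y : Fin (n + 1 + 1) → Fin m) 0 = f 0 := by
      rw [← Fin.castSucc_zero, Fin.snoc_castSucc]
    simp only [Fin.succ_castSucc, Fin.succ_last, Fin.snoc_castSucc, Fin.snoc_last, h0,
      Fin.val_castSucc, Fin.val_last, smul_eq_mul, hc]
    ring
  have key : (Pr.restrict (D ∩ E)).map ρ = c • (Pr.restrict D).map ρ := by
    refine ext_of_generate_finite _ generateFrom_pi.symm isPiSystem_pi ?_ ?_
    · rintro _ ⟨S, hS, rfl⟩
      exact hbox S fun k => hS k (Set.mem_univ k)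
    · have := hbox (fun _ => Set.univ) fun _ => MeasurableSet.univ
      rwa [Set.pi_univ] at this
  have := congrArg (fun ν => ν C) key
  simp only [Measure.smul_apply, Measure.map_apply hρm hC, Measure.restrict_apply (hρm hC),
    smul_eq_mul] at this
  rw [Set.inter_assoc, this]

/-- One-step Markov property. -/
theorem HasMarkovRewardLaw.measure_step [IsProbabilityMeasure Pr]
    (h : HasMarkovRewardLaw Pr P π μ s r)
    (hs : ∀ k, Measurable (s k)) (hr : ∀ k, Measurable (r k)) [∀ k x, IsFiniteMeasure (μ k x)]
    {n : ℕ} {A : Set Ω} (hA : MeasurableSet[historySigma s r n] A) (x y : Fin m) {B : Set ℝ}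
    (hB : MeasurableSet B) :
    Pr ((A ∩ {ω | s n ω = x}) ∩ {ω | s (n + 1) ω = y ∧ r (n + 1) ω ∈ B}) =
      (ENNReal.ofReal (P x y) * μ (n + 1) y B) * Pr (A ∩ {ω | s n ω = x}) := by
  obtain ⟨A', hA', rfl⟩ := hA
  have hE : MeasurableSet {ω | s (n + 1) ω = y ∧ r (n + 1) ω ∈ B} :=
    (hs _ (measurableSet_singleton y)).inter (hr _ hB)
  have hsec : ∀ f : Fin (n + 1) → Fin m, MeasurableSet (Prod.mk f ⁻¹' A') := fun f =>
    measurable_prodMk_left hA'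
  set ρ : Ω → Fin (n + 1) → ℝ := fun ω k => r (k : Fin (n + 1)) ω with hρ
  have hρm : Measurable ρ := measurable_pi_lambda _ fun k => hr k
  set D : (Fin (n + 1) → Fin m) → Set Ω := fun f => {ω | ∀ k : Fin (n + 1), s k ω = f k} with hDdef
  have hD : ∀ f, MeasurableSet (D f) := by
    intro f
    have : D f = ⋂ k : Fin (n + 1), s k ⁻¹' {f k} := by ext; simp [D]
    rw [this]
    exact MeasurableSet.iInter fun k => hs k (measurableSet_singleton _)
  have hdecomp : history s r n ⁻¹' A' ∩ {ω | s n ω = x} =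
      ⋃ f ∈ Finset.univ.filter (fun f : Fin (n + 1) → Fin m => f (Fin.last n) = x),
        ρ ⁻¹' (Prod.mk f ⁻¹' A') ∩ D f := by
    ext ω
    simp only [Set.mem_inter_iff, Set.mem_preimage, Set.mem_ofPred_eq, Finset.mem_filter,
      Finset.mem_univ, true_and, Set.mem_iUnion, exists_prop, D]
    constructor
    · rintro ⟨h1, h2⟩
      exact ⟨fun k => s k ω, h2, h1, fun _ => rfl⟩
    · rintro ⟨f, hf, h1, h2⟩
      have : f = fun k : Fin (n + 1) => s k ω := funext fun k => (h2 k).symm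
      subst this
      exact ⟨h1, hf⟩
  have hdisj : ∀ g : (Fin (n + 1) → Fin m) → Set Ω, (∀ f, g f ⊆ D f) →
      (↑(Finset.univ.filter (fun f : Fin (n + 1) → Fin m => f (Fin.last n) = x)) :
        Set (Fin (n + 1) → Fin m)).PairwiseDisjoint g := by
    intro g hg f _ f' _ hne
    refine Set.disjoint_left.2 fun ω h1 h2 => hne (funext fun k => ?_)
    rw [← hg f h1 k, ← hg f' h2 k]
  rw [hdecomp, Set.iUnion₂_inter, measure_biUnion_finset (hdisj _ ?_) ?_,
    measure_biUnion_finset (hdisj _ ?_) ?_, Finset.mul_sum]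
  · refine Finset.sum_congr rfl fun f hf => ?_
    rw [h.measure_path hs hr n f y (hsec f) hB, (Finset.mem_filter.1 hf).2]
  · exact fun f => Set.inter_subset_right
  · exact fun f _ => (hρm (hsec f)).inter (hD f)
  · exact fun f => Set.inter_subset_left.trans Set.inter_subset_right
  · exact fun f _ => ((hρm (hsec f)).inter (hD f)).inter hE

/-- Markov property over `j + 1` steps. -/
theorem HasMarkovRewardLaw.measure_gap [IsProbabilityMeasure Pr]
    (h : HasMarkovRewardLaw Pr P π μ s r)
    (hs : ∀ k, Measurable (s k)) (hr : ∀ k, Measurable (r k))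
    [∀ k x, IsProbabilityMeasure (μ k x)] (hP : P ∈ rowStochastic ℝ (Fin m))
    (j : ℕ) {n : ℕ} {A : Set Ω} (hA : MeasurableSet[historySigma s r n] A) (x y : Fin m)
    {B : Set ℝ} (hB : MeasurableSet B) :
    Pr ((A ∩ {ω | s n ω = x}) ∩ {ω | s (n + (j + 1)) ω = y ∧ r (n + (j + 1)) ω ∈ B}) =
      (ENNReal.ofReal ((P ^ (j + 1)) x y) * μ (n + (j + 1)) y B) * Pr (A ∩ {ω | s n ω = x}) := by
  induction j generalizing n A x with
  | zero => simpa using h.measure_step hs hr hA x y hB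
  | succ j ih =>
    have e : n + (j + 1 + 1) = n + 1 + (j + 1) := by ring
    set E := {ω | s (n + (j + 1 + 1)) ω = y ∧ r (n + (j + 1 + 1)) ω ∈ B} with hE
    have hEm : MeasurableSet E := (hs _ (measurableSet_singleton y)).inter (hr _ hB)
    have hA' : MeasurableSet[historySigma s r (n + 1)] (A ∩ {ω | s n ω = x}) :=
      MeasurableSet.inter (historySigma_mono s r (Nat.le_succ n) _ hA)
        (measurable_history_state s r (Nat.le_succ n) (measurableSet_singleton x))
    have hAm : MeasurableSet (A ∩ {ω | s n ω = x}) := historySigma_le hs hr _ _ hA'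
    have hdec : (A ∩ {ω | s n ω = x}) ∩ E =
        ⋃ z ∈ (Finset.univ : Finset (Fin m)), ((A ∩ {ω | s n ω = x}) ∩ {ω | s (n + 1) ω = z}) ∩ E := by
      ext ω
      simp
    have hterm : ∀ z, Pr (((A ∩ {ω | s n ω = x}) ∩ {ω | s (n + 1) ω = z}) ∩ E) =
        ENNReal.ofReal (P x z * (P ^ (j + 1)) z y) *
          (μ (n + (j + 1 + 1)) y B * Pr (A ∩ {ω | s n ω = x})) := by
      intro z
      have h1 := ih hA' z
      have h2 := h.measure_step hs hr hA x z MeasurableSet.univ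
      simp only [Set.mem_univ, and_true, measure_univ, mul_one] at h2
      rw [h2] at h1
      rw [hE, e, h1, ENNReal.ofReal_mul (nonneg_of_mem_rowStochastic hP)]
      ring
    rw [hdec, measure_biUnion_finset, Finset.sum_congr rfl fun z _ => hterm z, ← Finset.sum_mul,
      ← ENNReal.ofReal_sum_of_nonneg, pow_succ' P (j + 1), Matrix.mul_apply, mul_assoc]
    · exact fun z _ => mul_nonneg (nonneg_of_mem_rowStochastic hP)
        (nonneg_of_mem_rowStochastic (pow_mem hP _))
    · intro z _ z' _ hne
      refine Set.disjoint_left.2 fun ω h1 h2 => hne ?_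
      exact h1.1.2.symm.trans h2.1.2
    · exact fun z _ => (hAm.inter (hs _ (measurableSet_singleton z))).inter hEm

theorem lintegral_eq_sum_fiber {Y : Ω → Fin m} (hY : Measurable Y) (F : Ω → ENNReal)
    (A : Set Ω) :
    ∫⁻ ω in A, F ω ∂Pr = ∑ x, ∫⁻ ω in {ω | Y ω = x} ∩ A, F ω ∂Pr := by
  have h1 : ∀ x, MeasurableSet {ω | Y ω = x} := fun x => hY (measurableSet_singleton x)
  have h2 : (⋃ x ∈ (Finset.univ : Finset (Fin m)), {ω | Y ω = x}) = Set.univ := by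
    ext ω; simp
  have h3 := lintegral_biUnion_finset (μ := Pr.restrict A) (s := (Finset.univ : Finset (Fin m)))
    (t := fun x => {ω | Y ω = x}) (by
      intro x _ y _ hne
      exact Set.disjoint_left.2 fun ω h1 h2 => hne (h1.symm.trans h2)) (fun x _ => h1 x) F
  rw [h2, Measure.restrict_univ] at h3
  rw [h3]
  exact Finset.sum_congr rfl fun x _ => by rw [Measure.restrict_restrict (h1 x)]

/-- Conditioning on the history `j + 1` steps before the reward. -/
theorem HasMarkovRewardLaw.lintegral_gap [IsProbabilityMeasure Pr]
    (h : HasMarkovRewardLaw Pr P π μ s r)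
    (hs : ∀ k, Measurable (s k)) (hr : ∀ k, Measurable (r k))
    [∀ k x, IsProbabilityMeasure (μ k x)] (hP : P ∈ rowStochastic ℝ (Fin m))
    (j : ℕ) {n : ℕ} {Z : Ω → ENNReal} (hZ : Measurable[historySigma s r n] Z) {S : Ω → ℝ}
    (hS : Measurable[historySigma s r n] S) {g : ℝ → ENNReal} (hg : Measurable g)
    (φ : Fin m → ℝ) :
    ∫⁻ ω, Z ω * g (S ω + φ (s (n + (j + 1)) ω) * r (n + (j + 1)) ω) ∂Pr =
      ∑ x, ∑ y, ENNReal.ofReal ((P ^ (j + 1)) x y) *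
        ∫⁻ ω in {ω | s n ω = x}, Z ω * ∫⁻ u, g (S ω + φ y * u) ∂μ (n + (j + 1)) y ∂Pr := by
  set N := n + (j + 1) with hN
  have hle := historySigma_le hs hr n
  have hZS : Measurable[historySigma s r n] fun ω => (Z ω, S ω) := by
    let _ := historySigma s r n
    exact hZ.prodMk hS
  have hZSm : Measurable fun ω => (Z ω, S ω) := hZS.mono hle le_rfl
  have hD : ∀ k x, MeasurableSet {ω | s k ω = x} := fun k x => hs k (measurableSet_singleton x)
  rw [← setLIntegral_univ, lintegral_eq_sum_fiber (hs n)]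
  refine Finset.sum_congr rfl fun x _ => ?_
  rw [Set.inter_univ, lintegral_eq_sum_fiber (hs N)]
  refine Finset.sum_congr rfl fun y _ => ?_
  have hlaw : (ENNReal.ofReal ((P ^ (j + 1)) x y) •
      (Pr.restrict {ω | s n ω = x}).map fun ω => (Z ω, S ω)).prod (μ N y) =
      (Pr.restrict ({ω | s N ω = y} ∩ {ω | s n ω = x})).map fun ω => ((Z ω, S ω), r N ω) := by
    have : IsFiniteMeasure (ENNReal.ofReal ((P ^ (j + 1)) x y) •
      (Pr.restrict {ω | s n ω = x}).map fun ω => (Z ω, S ω)) :=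
      Measure.smul_finite _ ENNReal.ofReal_ne_top
    refine Measure.prod_eq fun A B hA hB => ?_
    have hA' : MeasurableSet[historySigma s r n] ((fun ω => (Z ω, S ω)) ⁻¹' A) := hZS hA
    rw [Measure.map_apply (hZSm.prodMk (hr N)) (hA.prod hB), Measure.restrict_apply
      ((hZSm.prodMk (hr N)) (hA.prod hB)), Measure.smul_apply, Measure.map_apply hZSm hA,
      Measure.restrict_apply (hZSm hA), smul_eq_mul, mul_right_comm,
      ← h.measure_gap hs hr hP j hA' x y hB]
    congr 1
    ext ω
    simp only [Set.mem_inter_iff, Set.mem_preimage, Set.mem_prod, Set.mem_ofPred_eq]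
    tauto
  have hF : Measurable fun p : (ENNReal × ℝ) × ℝ => p.1.1 * g (p.1.2 + φ y * p.2) := by
    fun_prop
  calc ∫⁻ ω in {ω | s N ω = y} ∩ {ω | s n ω = x}, Z ω * g (S ω + φ (s N ω) * r N ω) ∂Pr
      = ∫⁻ ω in {ω | s N ω = y} ∩ {ω | s n ω = x}, Z ω * g (S ω + φ y * r N ω) ∂Pr := by
        refine setLIntegral_congr_fun ((hD N y).inter (hD n x)) fun ω hω => ?_
        have : s N ω = y := hω.1
        simp only [this]
    _ = ∫⁻ p, p.1.1 * g (p.1.2 + φ y * p.2) ∂(Pr.restrict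
          ({ω | s N ω = y} ∩ {ω | s n ω = x})).map fun ω => ((Z ω, S ω), r N ω) :=
        (lintegral_map hF (hZSm.prodMk (hr N))).symm
    _ = ENNReal.ofReal ((P ^ (j + 1)) x y) *
        ∫⁻ ω in {ω | s n ω = x}, ∫⁻ u, Z ω * g (S ω + φ y * u) ∂μ N y ∂Pr := by
        rw [← hlaw, lintegral_prod _ hF.aemeasurable, lintegral_smul_measure, smul_eq_mul,
          lintegral_map hF.lintegral_prod_right' hZSm]
    _ = _ := by
        congr 1
        refine lintegral_congr fun ω => ?_
        rw [lintegral_const_mul]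
        fun_prop

/-- Averaging `g` over one uncontaminated stationary reward observation `φ · u`. -/
noncomputable def stationaryStep (π : Fin m → ℝ) (𝒟 : Fin m → Measure ℝ) (φ : Fin m → ℝ)
    (g : ℝ → ENNReal) (a : ℝ) : ENNReal :=
  ∑ y, ENNReal.ofReal (π y) * ∫⁻ u, g (a + φ y * u) ∂𝒟 y

variable {𝒟 : Fin m → Measure ℝ} {Q : ℕ → Fin m → Measure ℝ} {ε d : ℝ} {φ : Fin m → ℝ}

theorem measurable_stationaryStep [∀ x, IsProbabilityMeasure (𝒟 x)] {g : ℝ → ENNReal}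
    (hg : Measurable g) : Measurable (stationaryStep π 𝒟 φ g) := by
  unfold stationaryStep
  refine Finset.measurable_fun_sum _ fun y _ => Measurable.const_mul ?_ _
  have : Measurable fun p : ℝ × ℝ => g (p.1 + φ y * p.2) := by fun_prop
  exact this.lintegral_prod_right'

theorem stationaryStep_mono {g g' : ℝ → ENNReal} (h : ∀ a, g a ≤ g' a) (a : ℝ) :
    stationaryStep π 𝒟 φ g a ≤ stationaryStep π 𝒟 φ g' a :=
  Finset.sum_le_sum fun _ _ => mul_le_mul_right (lintegral_mono fun _ => h _) _

theorem stationaryStep_le_one [∀ x, IsProbabilityMeasure (𝒟 x)] (h0 : ∀ x, 0 ≤ π x)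
    (h1 : ∑ x, π x = 1) {g : ℝ → ENNReal} (h : ∀ a, g a ≤ 1) (a : ℝ) :
    stationaryStep π 𝒟 φ g a ≤ 1 := by
  refine (stationaryStep_mono h a).trans ?_
  simp only [stationaryStep, lintegral_const, measure_univ, mul_one]
  rw [← ENNReal.ofReal_sum_of_nonneg fun x _ => h0 x, h1, ENNReal.ofReal_one]

/-- Replacing one contaminated, almost stationary reward by an uncontaminated stationary one costs
at most `ε + d` for test functions with values in `[0, 1]`. -/
theorem HasMarkovRewardLaw.lintegral_gap_le [IsProbabilityMeasure Pr]
    (h : HasMarkovRewardLaw Pr P π μ s r)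
    (hs : ∀ k, Measurable (s k)) (hr : ∀ k, Measurable (r k))
    [∀ k x, IsProbabilityMeasure (μ k x)] (hP : P ∈ rowStochastic ℝ (Fin m))
    [∀ x, IsProbabilityMeasure (𝒟 x)] [∀ k x, IsProbabilityMeasure (Q k x)]
    (hε0 : 0 ≤ ε)
    (hμ : ∀ k x, μ k x = ENNReal.ofReal (1 - ε) • 𝒟 x + ENNReal.ofReal ε • Q k x)
    {j : ℕ} (hd0 : 0 ≤ d) (hd : ∀ x, ∑ y, |(P ^ (j + 1)) x y - π y| ≤ d)
    {n : ℕ} {Z : Ω → ENNReal} (hZ : Measurable[historySigma s r n] Z) {S : Ω → ℝ}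
    (hS : Measurable[historySigma s r n] S) {g : ℝ → ENNReal} (hg : Measurable g)
    (hg1 : ∀ a, g a ≤ 1) :
    ∫⁻ ω, Z ω * g (S ω + φ (s (n + (j + 1)) ω) * r (n + (j + 1)) ω) ∂Pr ≤
      ∫⁻ ω, Z ω * stationaryStep π 𝒟 φ g (S ω) ∂Pr + ENNReal.ofReal (ε + d) * ∫⁻ ω, Z ω ∂Pr := by
  have hle := historySigma_le hs hr n
  have hZm : Measurable Z := hZ.mono hle le_rfl
  have hSm : Measurable S := hS.mono hle le_rfl
  have hPs := pow_mem hP (j + 1)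
  set N := n + (j + 1)
  have hinner : ∀ y a, ∫⁻ u, g (a + φ y * u) ∂μ N y ≤
      ∫⁻ u, g (a + φ y * u) ∂𝒟 y + ENNReal.ofReal ε := by
    intro y a
    rw [hμ, lintegral_add_measure, lintegral_smul_measure, lintegral_smul_measure]
    refine add_le_add ?_ ?_
    · rw [smul_eq_mul]
      refine mul_le_of_le_one_left zero_le ?_
      exact ENNReal.ofReal_le_one.2 (by linarith)
    · rw [smul_eq_mul]
      refine mul_le_of_le_one_right zero_le ?_
      calc _ ≤ ∫⁻ _, 1 ∂Q N y := lintegral_mono fun u => hg1 _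
        _ = 1 := by simp
  have hone : ∀ y a, ∫⁻ u, g (a + φ y * u) ∂𝒟 y ≤ 1 := by
    intro y a
    calc _ ≤ ∫⁻ _, 1 ∂𝒟 y := lintegral_mono fun u => hg1 _
      _ = 1 := by simp
  have hpoint : ∀ x a, ∑ y, ENNReal.ofReal ((P ^ (j + 1)) x y) * ∫⁻ u, g (a + φ y * u) ∂μ N y ≤
      stationaryStep π 𝒟 φ g a + ENNReal.ofReal (ε + d) := by
    intro x a
    have hterm : ∀ y, ENNReal.ofReal ((P ^ (j + 1)) x y) * ∫⁻ u, g (a + φ y * u) ∂μ N y ≤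
        ENNReal.ofReal (π y) * ∫⁻ u, g (a + φ y * u) ∂𝒟 y +
          (ENNReal.ofReal |(P ^ (j + 1)) x y - π y| +
            ENNReal.ofReal ((P ^ (j + 1)) x y) * ENNReal.ofReal ε) := by
      intro y
      refine (mul_le_mul_right (hinner y a) _).trans ?_
      rw [mul_add, ← add_assoc]
      refine add_le_add_left ?_ _
      have hsplit : ENNReal.ofReal ((P ^ (j + 1)) x y) ≤
          ENNReal.ofReal (π y) + ENNReal.ofReal |(P ^ (j + 1)) x y - π y| := by
        refine le_trans (ENNReal.ofReal_le_ofReal ?_) ENNReal.ofReal_add_le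
        linarith [le_abs_self ((P ^ (j + 1)) x y - π y)]
      refine (mul_le_mul_left hsplit _).trans ?_
      rw [add_mul]
      exact add_le_add_right (mul_le_of_le_one_right zero_le (hone y a)) _
    refine (Finset.sum_le_sum fun y _ => hterm y).trans ?_
    rw [Finset.sum_add_distrib, Finset.sum_add_distrib, ← Finset.sum_mul,
      ← ENNReal.ofReal_sum_of_nonneg fun y _ => nonneg_of_mem_rowStochastic hPs,
      ← ENNReal.ofReal_sum_of_nonneg fun y _ => abs_nonneg _,
      sum_row_of_mem_rowStochastic hPs, ENNReal.ofReal_one, one_mul, add_comm ε d,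
      ENNReal.ofReal_add hd0 hε0]
    exact add_le_add_right (add_le_add_left (ENNReal.ofReal_le_ofReal (hd x)) _) _
  have hGm : ∀ y, Measurable fun ω => Z ω * ∫⁻ u, g (S ω + φ y * u) ∂μ N y := by
    intro y
    have : Measurable fun p : ℝ × ℝ => g (p.1 + φ y * p.2) := by fun_prop
    exact hZm.mul (this.lintegral_prod_right'.comp hSm)
  rw [h.lintegral_gap hs hr hP j hZ hS hg φ]
  calc _ = ∑ x, ∫⁻ ω in {ω | s n ω = x}, Z ω *
        ∑ y, ENNReal.ofReal ((P ^ (j + 1)) x y) * ∫⁻ u, g (S ω + φ y * u) ∂μ N y ∂Pr := by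
        refine Finset.sum_congr rfl fun x _ => ?_
        simp only [Finset.mul_sum]
        rw [lintegral_finsetSum]
        · refine Finset.sum_congr rfl fun y _ => ?_
          rw [← lintegral_const_mul _ (hGm y)]
          exact lintegral_congr fun ω => by ring
        · intro y _
          convert (hGm y).const_mul (ENNReal.ofReal ((P ^ (j + 1)) x y)) using 1
          exact funext fun ω => by ring
    _ ≤ ∑ x, ∫⁻ ω in {ω | s n ω = x}, Z ω *
        (stationaryStep π 𝒟 φ g (S ω) + ENNReal.ofReal (ε + d)) ∂Pr :=
        Finset.sum_le_sum fun x _ => lintegral_mono fun ω => mul_le_mul_right (hpoint x _) _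
    _ = ∫⁻ ω, Z ω * (stationaryStep π 𝒟 φ g (S ω) + ENNReal.ofReal (ε + d)) ∂Pr := by
        conv_rhs => rw [← setLIntegral_univ, lintegral_eq_sum_fiber (hs n)]
        simp only [Set.inter_univ]
    _ = _ := by
        simp only [mul_add]
        rw [lintegral_add_right _ (hZm.mul_const _), lintegral_mul_const _ hZm, mul_comm (lintegral _ _)]

/-- Bucket version of `HasMarkovRewardLaw.lintegral_gap_le`. -/
theorem HasMarkovRewardLaw.lintegral_bucket_le [IsProbabilityMeasure Pr]
    (h : HasMarkovRewardLaw Pr P π μ s r)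
    (hs : ∀ k, Measurable (s k)) (hr : ∀ k, Measurable (r k))
    [∀ k x, IsProbabilityMeasure (μ k x)] (hP : P ∈ rowStochastic ℝ (Fin m))
    (h0 : ∀ x, 0 ≤ π x) (h1 : ∑ x, π x = 1)
    [∀ x, IsProbabilityMeasure (𝒟 x)] [∀ k x, IsProbabilityMeasure (Q k x)]
    (hε0 : 0 ≤ ε)
    (hμ : ∀ k x, μ k x = ENNReal.ofReal (1 - ε) • 𝒟 x + ENNReal.ofReal ε • Q k x)
    {j : ℕ} (hd0 : 0 ≤ d) (hd : ∀ x, ∑ y, |(P ^ (j + 1)) x y - π y| ≤ d)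
    {n : ℕ} {Z : Ω → ENNReal} (hZ : Measurable[historySigma s r n] Z) (M : ℕ)
    {g : ℝ → ENNReal} (hg : Measurable g) (hg1 : ∀ a, g a ≤ 1) :
    ∫⁻ ω, Z ω * g (∑ i ∈ Finset.range M,
        φ (s (n + (i + 1) * (j + 1)) ω) * r (n + (i + 1) * (j + 1)) ω) ∂Pr ≤
      (((stationaryStep π 𝒟 φ)^[M] g) 0 + M * ENNReal.ofReal (ε + d)) * ∫⁻ ω, Z ω ∂Pr := by
  have hZm : Measurable Z := hZ.mono (historySigma_le hs hr n) le_rfl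
  induction M generalizing g with
  | zero => simp [lintegral_mul_const _ hZm, mul_comm]
  | succ M ih =>
    have hZ' : Measurable[historySigma s r (n + M * (j + 1))] Z :=
      hZ.mono (historySigma_mono s r (Nat.le_add_right _ _)) le_rfl
    have hS : Measurable[historySigma s r (n + M * (j + 1))] fun ω => ∑ i ∈ Finset.range M,
        φ (s (n + (i + 1) * (j + 1)) ω) * r (n + (i + 1) * (j + 1)) ω :=
      measurable_history_sum s r φ fun i hi =>
        Nat.add_le_add_left (Nat.mul_le_mul_right _ (Nat.succ_le_of_lt hi)) _
    have e : n + (M + 1) * (j + 1) = n + M * (j + 1) + (j + 1) := by ring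
    have hstep := h.lintegral_gap_le hs hr hP hε0 hμ hd0 hd hZ' hS hg hg1 (φ := φ)
    have hrec := ih (measurable_stationaryStep (π := π) (𝒟 := 𝒟) (φ := φ) hg)
      (stationaryStep_le_one h0 h1 hg1)
    simp only [Finset.sum_range_succ, e]
    refine hstep.trans ((add_le_add_left hrec _).trans_eq ?_)
    rw [Function.iterate_succ_apply, Nat.cast_succ]
    ring

theorem stationaryStep_iterate_mono {g g' : ℝ → ENNReal} (h : ∀ a, g a ≤ g' a) (k : ℕ) (a : ℝ) :
    (stationaryStep π 𝒟 φ)^[k] g a ≤ (stationaryStep π 𝒟 φ)^[k] g' a := by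
  induction k generalizing g g' with
  | zero => exact h a
  | succ k ih =>
    rw [Function.iterate_succ_apply, Function.iterate_succ_apply]
    exact ih (stationaryStep_mono h)

theorem stationaryStep_quadratic_le [∀ x, IsProbabilityMeasure (𝒟 x)] (h0 : ∀ x, 0 ≤ π x)
    (h1 : ∑ x, π x = 1) (hi1 : ∀ x, Integrable (fun u => u) (𝒟 x))
    (hi2 : ∀ x, Integrable (fun u => u ^ 2) (𝒟 x)) {b V : ℝ}
    (hb : ∑ x, π x * φ x * ∫ u, u ∂𝒟 x = b)
    (hV : ∑ x, π x * φ x ^ 2 * ∫ u, u ^ 2 ∂𝒟 x ≤ V) {κ e : ℝ} (hκ : 0 ≤ κ) (he : 0 ≤ e)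
    (c a : ℝ) :
    stationaryStep π 𝒟 φ (fun a => ENNReal.ofReal (κ * ((a - c) ^ 2 + e))) a ≤
      ENNReal.ofReal (κ * ((a - (c - b)) ^ 2 + (e + V))) := by
  have hsplit : ∀ y, (fun u => κ * ((a + φ y * u - c) ^ 2 + e)) = fun u =>
      κ * ((a - c) ^ 2 + e) + κ * (2 * (a - c) * φ y) * u + κ * φ y ^ 2 * u ^ 2 :=
    fun y => funext fun u => by ring
  have hA : ∀ y, Integrable (fun u : ℝ => κ * ((a - c) ^ 2 + e) + κ * (2 * (a - c) * φ y) * u)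
      (𝒟 y) := fun y => (integrable_const _).add ((hi1 y).const_mul _)
  have hB : ∀ y, Integrable (fun u : ℝ => κ * φ y ^ 2 * u ^ 2) (𝒟 y) :=
    fun y => (hi2 y).const_mul _
  have hval : ∀ y, ∫ u, κ * ((a + φ y * u - c) ^ 2 + e) ∂𝒟 y =
      κ * ((a - c) ^ 2 + e) + κ * (2 * (a - c) * φ y) * ∫ u, u ∂𝒟 y +
        κ * φ y ^ 2 * ∫ u, u ^ 2 ∂𝒟 y := by
    intro y
    have h2 := integral_const_mul (μ := 𝒟 y) (κ * φ y ^ 2) fun u : ℝ => u ^ 2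
    have h3 := integral_const_mul (μ := 𝒟 y) (κ * (2 * (a - c) * φ y)) fun u : ℝ => u
    rw [hsplit, integral_add (hA y) (hB y), integral_add (integrable_const _)
      ((hi1 y).const_mul _), h2, h3]
    simp
  have hpos : ∀ y u, 0 ≤ κ * ((a + φ y * u - c) ^ 2 + e) := fun y u => by positivity
  have hint : ∀ y, ∫⁻ u, ENNReal.ofReal (κ * ((a + φ y * u - c) ^ 2 + e)) ∂𝒟 y =
      ENNReal.ofReal (κ * ((a - c) ^ 2 + e) + κ * (2 * (a - c) * φ y) * ∫ u, u ∂𝒟 y +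
        κ * φ y ^ 2 * ∫ u, u ^ 2 ∂𝒟 y) := by
    intro y
    rw [← hval, ofReal_integral_eq_lintegral_ofReal]
    · rw [hsplit]; exact (hA y).add (hB y)
    · exact Filter.Eventually.of_forall (hpos y)
  have hnn : ∀ y, 0 ≤ κ * ((a - c) ^ 2 + e) + κ * (2 * (a - c) * φ y) * ∫ u, u ∂𝒟 y +
        κ * φ y ^ 2 * ∫ u, u ^ 2 ∂𝒟 y := fun y => hval y ▸ integral_nonneg (hpos y)
  unfold stationaryStep
  simp only [hint]
  rw [Finset.sum_congr rfl fun y _ => (ENNReal.ofReal_mul (h0 y)).symm,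
    ← ENNReal.ofReal_sum_of_nonneg fun y _ => mul_nonneg (h0 y) (hnn y)]
  refine ENNReal.ofReal_le_ofReal ?_
  have hsum : ∑ y, π y * (κ * ((a - c) ^ 2 + e) + κ * (2 * (a - c) * φ y) * ∫ u, u ∂𝒟 y +
      κ * φ y ^ 2 * ∫ u, u ^ 2 ∂𝒟 y) = κ * ((a - c) ^ 2 + e) + κ * (2 * (a - c)) * b +
      κ * ∑ y, π y * φ y ^ 2 * ∫ u, u ^ 2 ∂𝒟 y := by
    rw [← hb, Finset.mul_sum, Finset.mul_sum]
    nth_rewrite 2 [← mul_one (κ * ((a - c) ^ 2 + e))]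
    rw [← h1, Finset.mul_sum, ← Finset.sum_add_distrib, ← Finset.sum_add_distrib]
    exact Finset.sum_congr rfl fun y _ => by ring
  rw [hsum]
  nlinarith [mul_le_mul_of_nonneg_left hV hκ, mul_nonneg hκ (sq_nonneg b)]

/-- Chebyshev's inequality for the sum of `M` uncontaminated stationary rewards. -/
theorem stationaryStep_iterate_indicator_le [∀ x, IsProbabilityMeasure (𝒟 x)]
    (h0 : ∀ x, 0 ≤ π x) (h1 : ∑ x, π x = 1) (hi1 : ∀ x, Integrable (fun u => u) (𝒟 x))
    (hi2 : ∀ x, Integrable (fun u => u ^ 2) (𝒟 x)) {b V : ℝ}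
    (hb : ∑ x, π x * φ x * ∫ u, u ∂𝒟 x = b) (hV0 : 0 ≤ V)
    (hV : ∑ x, π x * φ x ^ 2 * ∫ u, u ^ 2 ∂𝒟 x ≤ V) (M : ℕ) {x : ℝ} (hx : 0 < x) :
    (stationaryStep π 𝒟 φ)^[M] ({a | x < |a - M * b|}.indicator 1) 0 ≤
      ENNReal.ofReal (M * V / x ^ 2) := by
  have hind : ∀ a, ({a | x < |a - M * b|}.indicator 1 : ℝ → ENNReal) a ≤
      ENNReal.ofReal (1 / x ^ 2 * ((a - M * b) ^ 2 + 0)) := by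
    intro a
    refine Set.indicator_apply_le' (fun ha => ?_) fun _ => zero_le
    rw [Pi.one_apply, ENNReal.one_le_ofReal, add_zero, ← sq_abs (a - M * b), one_div,
      ← div_eq_inv_mul, one_le_div (by positivity)]
    have ha' : x < |a - M * b| := ha
    gcongr
  have hiter : ∀ (k : ℕ) (c e a : ℝ), 0 ≤ e →
      (stationaryStep π 𝒟 φ)^[k] (fun a => ENNReal.ofReal (1 / x ^ 2 * ((a - c) ^ 2 + e))) a ≤
        ENNReal.ofReal (1 / x ^ 2 * ((a - (c - k * b)) ^ 2 + (e + k * V))) := by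
    intro k
    induction k with
    | zero => intro c e a _; simp
    | succ k ih =>
      intro c e a he
      rw [Function.iterate_succ_apply]
      refine (stationaryStep_iterate_mono (stationaryStep_quadratic_le h0 h1 hi1 hi2 hb hV
        (by positivity) he c) k a).trans ((ih _ _ _ (add_nonneg he hV0)).trans_eq ?_)
      push_cast
      ring_nf
  refine (stationaryStep_iterate_mono hind M 0).trans ((hiter M _ _ _ le_rfl).trans_eq ?_)
  congr 1
  ring

/-- The number of buckets exceeding the deviation level is at least `L / 2` with exponentially
small probability. -/
theorem HasMarkovRewardLaw.measure_half_buckets_le [IsProbabilityMeasure Pr]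
    (h : HasMarkovRewardLaw Pr P π μ s r)
    (hs : ∀ k, Measurable (s k)) (hr : ∀ k, Measurable (r k))
    [∀ k x, IsProbabilityMeasure (μ k x)] (hP : P ∈ rowStochastic ℝ (Fin m))
    (h0 : ∀ x, 0 ≤ π x) (h1 : ∑ x, π x = 1)
    [∀ x, IsProbabilityMeasure (𝒟 x)] [∀ k x, IsProbabilityMeasure (Q k x)]
    (hε0 : 0 ≤ ε)
    (hμ : ∀ k x, μ k x = ENNReal.ofReal (1 - ε) • 𝒟 x + ENNReal.ofReal ε • Q k x)
    {τ : ℕ} (hτ : 0 < τ) (hd0 : 0 ≤ d) (hd : ∀ x, ∑ y, |(P ^ τ) x y - π y| ≤ d)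
    (hi1 : ∀ x, Integrable (fun u => u) (𝒟 x))
    (hi2 : ∀ x, Integrable (fun u => u ^ 2) (𝒟 x)) {b V : ℝ}
    (hb : ∑ x, π x * φ x * ∫ u, u ∂𝒟 x = b) (hV0 : 0 ≤ V)
    (hV : ∑ x, π x * φ x ^ 2 * ∫ u, u ^ 2 ∂𝒟 x ≤ V) {M : ℕ} (hM : 0 < M) {x : ℝ} (hx : 0 < x)
    (hp : M * V / x ^ 2 + M * (ε + d) ≤ 1 / 6) {L : ℕ} (hL : 0 < L) :
    Pr {ω | L ≤ 2 * ((Finset.range L).filter fun l => x < |∑ i ∈ Finset.range M,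
        φ (s ((l * M + i) * τ) ω) * r ((l * M + i) * τ) ω - M * b|).card} ≤
      ENNReal.ofReal (4 * (3 / 4) ^ L) := by
  obtain ⟨j, rfl⟩ := Nat.exists_eq_succ_of_ne_zero hτ.ne'
  obtain ⟨L, rfl⟩ := Nat.exists_eq_succ_of_ne_zero hL.ne'
  obtain ⟨M', rfl⟩ := Nat.exists_eq_succ_of_ne_zero hM.ne'
  set M := M'.succ with hMdef
  set τ := j.succ with hτdef
  set W : ℕ → Ω → ℝ := fun l ω => ∑ i ∈ Finset.range M,
    φ (s ((l * M + i) * τ) ω) * r ((l * M + i) * τ) ω with hW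
  set g : ℝ → ENNReal := {a | x < |a - M * b|}.indicator 1 with hg
  have hgm : Measurable g := by
    refine measurable_one.indicator ?_
    exact measurableSet_lt measurable_const (by fun_prop)
  have hg1 : ∀ a, g a ≤ 1 := fun a => Set.indicator_apply_le' (fun _ => le_rfl) fun _ => zero_le
  have hWhist : ∀ l n, (l * M + M') * τ ≤ n → Measurable[historySigma s r n] (W l) := by
    intro l n hn
    refine measurable_history_sum s r φ fun i hi => le_trans ?_ hn
    exact Nat.mul_le_mul_right _ (Nat.add_le_add_left (Nat.lt_succ_iff.1 hi) _)
  set Z : ℕ → Ω → ENNReal := fun J ω => ∏ l ∈ Finset.range J, (1 + 3 * g (W (l + 1) ω)) with hZ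
  have hZhist : ∀ J, Measurable[historySigma s r ((J * M + M') * τ)] (Z J) := by
    intro J
    let _ := historySigma s r ((J * M + M') * τ)
    refine Finset.measurable_fun_prod _ fun l hl => ?_
    have := hWhist (l + 1) ((J * M + M') * τ) (Nat.mul_le_mul_right _ (Nat.add_le_add_right
      (Nat.mul_le_mul_right _ (Finset.mem_range.1 hl)) _))
    exact ((hgm.comp this).const_mul 3).const_add 1
  have hZm : ∀ J, Measurable (Z J) := fun J => (hZhist J).mono (historySigma_le hs hr _) le_rfl
  have hZint : ∀ J, ∫⁻ ω, Z J ω ∂Pr ≤ ENNReal.ofReal (3 / 2) ^ J := by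
    intro J
    induction J with
    | zero => simp [Z]
    | succ J ih =>
      have hbk := h.lintegral_bucket_le hs hr hP h0 h1 hε0 hμ hd0 hd (hZhist J) M hgm hg1 (φ := φ)
      have hidx : ∀ i, (J * M + M') * τ + (i + 1) * τ = ((J + 1) * M + i) * τ := by
        intro i; rw [hMdef]; simp only [Nat.succ_eq_add_one]; ring
      simp only [← Nat.succ_eq_add_one j, ← hτdef, hidx] at hbk
      have hfac : ((stationaryStep π 𝒟 φ)^[M] g) 0 + M * ENNReal.ofReal (ε + d) ≤
          ENNReal.ofReal (1 / 6) := by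
        refine (add_le_add_left (stationaryStep_iterate_indicator_le h0 h1 hi1 hi2 hb hV0 hV M hx)
          _).trans ?_
        rw [← ENNReal.ofReal_natCast, ← ENNReal.ofReal_mul (by positivity),
          ← ENNReal.ofReal_add (by positivity) (by positivity)]
        exact ENNReal.ofReal_le_ofReal hp
      calc ∫⁻ ω, Z (J + 1) ω ∂Pr = ∫⁻ ω, Z J ω + 3 * (Z J ω * g (W (J + 1) ω)) ∂Pr := by
            refine lintegral_congr fun ω => ?_
            simp only [Z, Finset.prod_range_succ]
            ring
        _ = ∫⁻ ω, Z J ω ∂Pr + 3 * ∫⁻ ω, Z J ω * g (W (J + 1) ω) ∂Pr := by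
            rw [lintegral_add_left (hZm J), lintegral_const_mul' _ _ (by norm_num)]
        _ ≤ ∫⁻ ω, Z J ω ∂Pr + 3 * (ENNReal.ofReal (1 / 6) * ∫⁻ ω, Z J ω ∂Pr) := by
            gcongr
            exact hbk.trans (mul_le_mul_left hfac _)
        _ = ENNReal.ofReal (3 / 2) * ∫⁻ ω, Z J ω ∂Pr := by
            have : ENNReal.ofReal (3 / 2) = 1 + 3 * ENNReal.ofReal (1 / 6) := by
              rw [← ENNReal.ofReal_one, ← ENNReal.ofReal_ofNat 3, ← ENNReal.ofReal_mul (by norm_num),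
                ← ENNReal.ofReal_add (by norm_num) (by norm_num)]
              norm_num
            rw [this]; ring
        _ ≤ ENNReal.ofReal (3 / 2) ^ (J + 1) := by
            rw [pow_succ']
            exact mul_le_mul_right ih _
  have hsub : {ω | L.succ ≤ 2 * ((Finset.range L.succ).filter
      fun l => x < |W l ω - M * b|).card} ⊆ {ω | 2 ^ L.succ ≤ 4 * Z L ω} := by
    intro ω hω
    have hω' : L.succ ≤ 2 * ((Finset.range L.succ).filter fun l => x < |W l ω - M * b|).card := hω
    have hZeq : Z L ω = 4 ^ ((Finset.range L).filter fun l => x < |W (l + 1) ω - M * b|).card := by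
      rw [← Finset.prod_const, Finset.prod_filter]
      refine Finset.prod_congr rfl fun l _ => ?_
      simp only [g, Set.indicator_apply, Set.mem_ofPred_eq, Pi.one_apply]
      split_ifs <;> norm_num
    have hcard : ((Finset.range L.succ).filter fun l => x < |W l ω - M * b|).card ≤
        ((Finset.range L).filter fun l => x < |W (l + 1) ω - M * b|).card + 1 := by
      rw [Finset.card_filter, Finset.card_filter, Finset.sum_range_succ']
      gcongr
      split_ifs <;> norm_num
    show (2 : ENNReal) ^ L.succ ≤ 4 * Z L ω
    rw [hZeq, ← pow_succ', show (4 : ENNReal) = 2 ^ 2 by norm_num, ← pow_mul]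
    exact pow_le_pow_right₀ (by norm_num) (by omega)
  refine (measure_mono hsub).trans ?_
  have hmk := mul_meas_ge_le_lintegral (μ := Pr) ((hZm L).const_mul 4) (2 ^ L.succ)
  rw [lintegral_const_mul _ (hZm L)] at hmk
  have h2 : (2 : ENNReal) ^ L.succ * Pr {ω | 2 ^ L.succ ≤ 4 * Z L ω} ≤
      2 ^ L.succ * ENNReal.ofReal (4 * (3 / 4) ^ L.succ) := by
    refine hmk.trans ((mul_le_mul_right (hZint L) _).trans ?_)
    rw [← ENNReal.ofReal_pow (by norm_num), ← ENNReal.ofReal_ofNat 4, ← ENNReal.ofReal_ofNat 2,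
      ← ENNReal.ofReal_pow (by norm_num), ← ENNReal.ofReal_mul (by norm_num),
      ← ENNReal.ofReal_mul (by positivity)]
    refine ENNReal.ofReal_le_ofReal ?_
    have e : (2 : ℝ) ^ L.succ * (4 * (3 / 4) ^ L.succ) = 4 * (3 / 2) ^ L.succ := by
      rw [mul_left_comm, ← mul_pow]; norm_num
    have : (0 : ℝ) ≤ (3 / 2) ^ L := by positivity
    rw [e, pow_succ (3 / 2 : ℝ)]
    linarith
  exact (ENNReal.mul_le_mul_iff_right (by positivity) (by finiteness)).1 h2

end MarkovReward

section Parameters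

theorem log_le_nat_mul_log {x y : ℝ} (hy : 0 < y) {k : ℕ} (h : y ≤ x ^ k) :
    Real.log y ≤ k * Real.log x := by
  rw [← Real.log_pow]
  exact Real.log_le_log hy h

variable {K T t tmix : ℕ} {ε : ℝ}

theorem log_two_le_log_mul (hK : 1 ≤ K) (hT : 2 ≤ T) : 0.69 ≤ Real.log (K * T : ℝ) := by
  have hK' : (1 : ℝ) ≤ K := by exact_mod_cast hK
  have hT' : (2 : ℝ) ≤ T := by exact_mod_cast hT
  have h2 : Real.log 2 ≤ Real.log (K * T : ℝ) :=
    Real.log_le_log (by norm_num) (by nlinarith)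
  linarith [Real.log_two_gt_d9]

theorem log_noise_bounds (hK : 1 ≤ K) (hT : 2 ≤ T) :
    Real.log (K * T : ℝ) ≤ Real.log (12 * K * T ^ 3 : ℝ) ∧
      Real.log (12 * K * T ^ 3 : ℝ) ≤ 7 * Real.log (K * T : ℝ) := by
  have hK' : (1 : ℝ) ≤ K := by exact_mod_cast hK
  have hT' : (2 : ℝ) ≤ T := by exact_mod_cast hT
  have hX : (2 : ℝ) ≤ K * T := by nlinarith
  have hTX : (T : ℝ) ≤ K * T := by nlinarith
  have h3 : (K : ℝ) * T ^ 3 ≤ (K * T : ℝ) ^ 3 := by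
    rw [mul_pow]
    exact mul_le_mul_of_nonneg_right (le_self_pow₀ hK' (by norm_num)) (by positivity)
  refine ⟨Real.log_le_log (by positivity) ?_, ?_⟩
  · have : (1 : ℝ) ≤ T ^ 2 := one_le_pow₀ (by linarith)
    calc (K * T : ℝ) = K * T * 1 := by ring
      _ ≤ K * T * (12 * T ^ 2) := by gcongr; linarith
      _ = 12 * K * T ^ 3 := by ring
  · refine (log_le_nat_mul_log (x := (K * T : ℝ)) (k := 7) (by positivity) ?_).trans_eq (by norm_num)
    have h4 : (2 : ℝ) ^ 4 ≤ (K * T : ℝ) ^ 4 := by gcongr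
    calc (12 * K * T ^ 3 : ℝ) = 12 * (K * T ^ 3) := by ring
      _ ≤ (K * T : ℝ) ^ 4 * (K * T : ℝ) ^ 3 := by
        refine mul_le_mul (by linarith) h3 (by positivity) (by positivity)
      _ = _ := by ring

/-- The confidence-dependent logarithms are of order `log (K T)`. -/
theorem rumem_log_bounds (hK : 1 ≤ K) (hT : 2 ≤ T) (htT : t ≤ T) :
    Real.logb 2 (6 * (t + 1 : ℕ) / (1 / (K * T ^ 2 : ℝ))) ≤ 11 * Real.log (K * T : ℝ) ∧
    1 ≤ Real.log (24 / (1 / (K * T ^ 2 : ℝ))) ∧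
    Real.log (24 / (1 / (K * T ^ 2 : ℝ))) ≤ 7 * Real.log (K * T : ℝ) ∧
    0 ≤ Real.log ((t + 1 : ℕ) / (1 / (K * T ^ 2 : ℝ))) ∧
    Real.log ((t + 1 : ℕ) / (1 / (K * T ^ 2 : ℝ))) ≤ 4 * Real.log (K * T : ℝ) := by
  have hl := log_two_le_log_mul hK hT
  have hK' : (1 : ℝ) ≤ K := by exact_mod_cast hK
  have hT' : (2 : ℝ) ≤ T := by exact_mod_cast hT
  have ht' : (t : ℝ) ≤ T := by exact_mod_cast htT
  have ht0 : (0 : ℝ) ≤ t := t.cast_nonneg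
  set X : ℝ := K * T with hX
  have hX2 : (2 : ℝ) ≤ X := by rw [hX]; nlinarith
  have hTX : (T : ℝ) ≤ X := by rw [hX]; nlinarith
  have hδ : (K * T ^ 2 : ℝ) ≤ X ^ 2 := by
    rw [hX, mul_pow]
    exact mul_le_mul_of_nonneg_right (le_self_pow₀ hK' (by norm_num)) (by positivity)
  have hδ1 : (1 : ℝ) ≤ K * T ^ 2 := by
    have : (1 : ℝ) ≤ T ^ 2 := one_le_pow₀ (by linarith)
    nlinarith
  have hX4 : (16 : ℝ) ≤ X ^ 4 := by
    calc (16 : ℝ) = 2 ^ 4 := by norm_num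
      _ ≤ X ^ 4 := by gcongr
  have hX5 : (32 : ℝ) ≤ X ^ 5 := by
    calc (32 : ℝ) = 2 ^ 5 := by norm_num
      _ ≤ X ^ 5 := by gcongr
  have hN : ((t : ℝ) + 1) * (K * T ^ 2) ≤ 2 * X ^ 3 := by
    calc ((t : ℝ) + 1) * (K * T ^ 2) ≤ (2 * X) * X ^ 2 := by gcongr; linarith
      _ = 2 * X ^ 3 := by ring
  simp only [div_div_eq_mul_div, div_one, Nat.cast_add, Nat.cast_one]
  have hX0 : 0 < X := by linarith
  refine ⟨?_, ?_, ?_, ?_, ?_⟩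
  · have h7 : Real.log (6 * ((t : ℝ) + 1) * (K * T ^ 2)) ≤ (7 : ℕ) * Real.log X := by
      refine log_le_nat_mul_log (by positivity) ?_
      calc 6 * ((t : ℝ) + 1) * (K * T ^ 2) ≤ 12 * X ^ 3 := by linarith
        _ ≤ X ^ 4 * X ^ 3 := by gcongr; linarith
        _ = X ^ 7 := by ring
    rw [Real.logb, div_le_iff₀ (Real.log_pos (by norm_num))]
    push_cast at h7
    nlinarith [Real.log_two_gt_d9]
  · have h4 : Real.log (2 ^ 2 : ℝ) ≤ Real.log (24 * (K * T ^ 2 : ℝ)) :=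
      Real.log_le_log (by norm_num) (by linarith)
    rw [Real.log_pow] at h4
    push_cast at h4
    linarith [Real.log_two_gt_d9]
  · refine (log_le_nat_mul_log (x := X) (k := 7) (by positivity) ?_).trans_eq (by norm_num)
    calc 24 * (K * T ^ 2 : ℝ) ≤ X ^ 5 * X ^ 2 := by gcongr; linarith
      _ = X ^ 7 := by ring
  · exact Real.log_nonneg (by nlinarith)
  · refine (log_le_nat_mul_log (x := X) (k := 4) (by positivity) ?_).trans_eq (by norm_num)
    calc ((t : ℝ) + 1) * (K * T ^ 2) ≤ 2 * X ^ 3 := hN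
      _ ≤ X * X ^ 3 := by gcongr
      _ = X ^ 4 := by ring

/-- The subsampling gap spans `k` mixing times with `2 ^ (1 - k) ≤ 2 δ / (3 N)`. -/
theorem exists_mul_le_rumemTau (tmix : ℕ) {N : ℕ} (hN : 1 ≤ N) {δ : ℝ} (hδ : 0 < δ) (hδ1 : δ ≤ 1) :
    ∃ k : ℕ, k * tmix ≤ rumemTau tmix N δ ∧ 2 * (1 / 2 : ℝ) ^ k ≤ 2 * δ / (3 * N) := by
  have hN' : (1 : ℝ) ≤ N := by exact_mod_cast hN
  have h1 : (1 : ℝ) ≤ 6 * N / δ := by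
    rw [le_div_iff₀ hδ]; linarith
  have hlog : 0 ≤ Real.logb 2 (6 * N / δ) := Real.logb_nonneg (by norm_num) h1
  refine ⟨⌊Real.logb 2 (6 * N / δ)⌋₊, ?_, ?_⟩
  · have h2 : ((⌊Real.logb 2 (6 * N / δ)⌋₊ * tmix : ℕ) : ℝ) ≤ (rumemTau tmix N δ : ℝ) := by
      rw [Nat.cast_mul, rumemTau]
      exact (mul_le_mul_of_nonneg_right (Nat.floor_le hlog) (Nat.cast_nonneg _)).trans
        (Nat.le_ceil _)
    exact_mod_cast h2
  · set k := ⌊Real.logb 2 (6 * N / δ)⌋₊ with hk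
    have h3 : Real.logb 2 (6 * N / δ) ≤ ((k + 1 : ℕ) : ℝ) := by
      push_cast; exact (Nat.lt_floor_add_one _).le
    rw [Real.logb_le_iff_le_rpow (by norm_num) (by linarith), Real.rpow_natCast,
      div_le_iff₀ hδ, pow_succ] at h3
    rw [one_div, inv_pow, ← div_eq_mul_inv, div_le_div_iff₀ (by positivity) (by positivity)]
    linarith

set_option maxHeartbeats 800000 in
/-- Quantitative consequences of the burn-in condition for the RUMEM parameters. -/
theorem rumem_parameter_bounds (hK : 1 ≤ K) (hT : 2 ≤ T) (htT : t ≤ T) (htmix : 1 ≤ tmix)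
    (hε0 : 0 ≤ ε) (hε1 : ε ≤ 1 / 192)
    (hburn : 300000 * (tmix : ℝ) * Real.log (K * T : ℝ) ^ 2 ≤ t)
    {δ : ℝ} (hδ : δ = 1 / (K * T ^ 2 : ℝ)) {τ L M : ℕ}
    (hτ : τ = rumemTau tmix (t + 1) δ) (hL : L = rumemL tmix (t + 1) δ ε)
    (hM : M = rumemn tmix (t + 1) δ / L) :
    0 < τ ∧ 0 < L ∧ 0 < M ∧ (M : ℝ) * (ε + 2 * δ / (3 * (t + 1 : ℕ))) ≤ 1 / 8 ∧
      1 / (M : ℝ) ≤ 24 * ε + 27170 * (Real.log (K * T : ℝ) ^ 2 * tmix / t) ∧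
      4 * (3 / 4 : ℝ) ^ L ≤ δ := by
  have hl := log_two_le_log_mul hK hT
  obtain ⟨hb1, hb2, hb3, hb4, hb5⟩ := rumem_log_bounds hK hT htT
  rw [← hδ] at hb1 hb2 hb3 hb4 hb5
  set l := Real.log (K * T : ℝ)
  have hK' : (1 : ℝ) ≤ K := by exact_mod_cast hK
  have hT' : (2 : ℝ) ≤ T := by exact_mod_cast hT
  have hm : (1 : ℝ) ≤ tmix := by exact_mod_cast htmix
  have hδ0 : 0 < δ := by rw [hδ]; positivity
  have hδ1 : δ ≤ 1 := by
    rw [hδ, div_le_one (by positivity)]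
    nlinarith
  have hlm : 0.69 ≤ l * tmix := by nlinarith
  have ht0 : (0 : ℝ) < t := by
    refine lt_of_lt_of_le ?_ hburn
    positivity
  have hlogb : 0 < Real.logb 2 (6 * (t + 1 : ℕ) / δ) := by
    refine Real.logb_pos (by norm_num) ?_
    rw [lt_div_iff₀ hδ0]
    push_cast
    linarith
  have hτ0 : 0 < τ := by
    rw [hτ, rumemTau]
    exact Nat.ceil_pos.2 (mul_pos hlogb (by linarith))
  have hτle : (τ : ℝ) ≤ 13 * (l * tmix) := by
    have h1 : (τ : ℝ) < Real.logb 2 (6 * (t + 1 : ℕ) / δ) * tmix + 1 := by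
      rw [hτ, rumemTau]
      exact Nat.ceil_lt_add_one (by positivity)
    have h2 := mul_le_mul_of_nonneg_right hb1 (by linarith : (0 : ℝ) ≤ tmix)
    linarith
  set n := rumemn tmix (t + 1) δ with hn
  have hndef : n = t / τ + 1 := by rw [hn, rumemn, ← hτ, Nat.add_sub_cancel]
  have hnN : (n : ℝ) ≤ (t + 1 : ℕ) := by
    rw [hndef]; exact_mod_cast Nat.succ_le_succ (Nat.div_le_self t τ)
  have htn : (t : ℝ) ≤ 13 * (l * tmix) * n := by
    have h1 : t < τ * n := by rw [hndef]; exact Nat.lt_mul_div_succ t hτ0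
    have h2 : (t : ℝ) ≤ τ * n := by exact_mod_cast h1.le
    exact h2.trans (mul_le_mul_of_nonneg_right hτle (Nat.cast_nonneg _))
  have hn0 : (0 : ℝ) < n := by rw [hndef]; positivity
  have hln : 20000 * l ≤ n := by
    have h1 : l * tmix * (300000 * l) ≤ l * tmix * (13 * n) := by nlinarith
    have h2 := le_of_mul_le_mul_left h1 (by positivity)
    linarith
  have harg : 12 * rumemEps' tmix (t + 1) δ ε * (n : ℝ) + 256 / 7 * Real.log ((t + 1 : ℕ) / δ) =
      12 * ε * n + 128 * Real.log (24 / δ) + 256 / 7 * Real.log ((t + 1 : ℕ) / δ) := by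
    rw [rumemEps', ← hn]
    field_simp
    ring
  have hεn : 0 ≤ ε * n := by positivity
  have hLle : (L : ℝ) ≤ 12 * ε * n + 1045 * l := by
    have h1 : (L : ℝ) < 12 * ε * n + 128 * Real.log (24 / δ) +
        256 / 7 * Real.log ((t + 1 : ℕ) / δ) + 1 := by
      rw [← harg, hL, rumemL]
      refine Nat.ceil_lt_add_one ?_
      rw [harg]
      linarith
    linarith
  have hLge : 12 * ε * n + 128 * Real.log (24 / δ) ≤ L := by
    have h1 : 12 * ε * n + 128 * Real.log (24 / δ) +
        256 / 7 * Real.log ((t + 1 : ℕ) / δ) ≤ (L : ℝ) := by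
      rw [← harg, hL, rumemL]
      exact Nat.le_ceil _
    linarith
  have hL0' : (128 : ℝ) ≤ L := by linarith
  have hL0 : 0 < L := by
    have : (0 : ℝ) < L := by linarith
    exact_mod_cast this
  have hLn : (L : ℝ) ≤ n := by
    have : ε * n ≤ 1 / 192 * n := mul_le_mul_of_nonneg_right hε1 hn0.le
    linarith
  have hM0 : 0 < M := by
    rw [hM]
    exact Nat.div_pos (by exact_mod_cast hLn) hL0
  have hM0' : (1 : ℝ) ≤ M := by exact_mod_cast hM0
  have hML : (M : ℝ) * L ≤ n := by
    rw [hM]; exact_mod_cast Nat.div_mul_le_self n L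
  have hnML : (n : ℝ) ≤ 2 * (M * L) := by
    have h1 : n < L * (M + 1) := by rw [hM]; exact Nat.lt_mul_div_succ n hL0
    have h2 : (n : ℝ) ≤ L * (M + 1) := by exact_mod_cast h1.le
    have h3 : (L : ℝ) * 1 ≤ L * M := mul_le_mul_of_nonneg_left hM0' (by linarith)
    linarith
  refine ⟨hτ0, hL0, hM0, ?_, ?_, ?_⟩
  · have h1 : (M : ℝ) * ε ≤ 1 / 12 := by
      have h3 : (M : ℝ) * (12 * ε * n) ≤ M * L := mul_le_mul_of_nonneg_left (by linarith) (by linarith)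
      have : (M * ε) * n ≤ 1 / 12 * n := by linarith
      exact le_of_mul_le_mul_right this hn0
    have hN0 : (0 : ℝ) < (t + 1 : ℕ) := by positivity
    have h2 : (M : ℝ) * (2 * δ / (3 * (t + 1 : ℕ))) ≤ 1 / 24 := by
      rw [mul_div_assoc', div_le_iff₀ (by positivity)]
      have h3 : (M : ℝ) * 128 ≤ M * L := mul_le_mul_of_nonneg_left hL0' (by linarith)
      have h4 : (M : ℝ) * δ ≤ M * 1 := mul_le_mul_of_nonneg_left hδ1 (by linarith)
      linarith
    rw [mul_add]
    linarith
  · have h1 : 1 / (M : ℝ) ≤ 2 * L / n := by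
      rw [div_le_div_iff₀ (by linarith) hn0]; linarith
    have h2 : 2 * (L : ℝ) / n ≤ 24 * ε + 2090 * (l / n) := by
      rw [div_le_iff₀ hn0]
      have : (24 * ε + 2090 * (l / n)) * n = 24 * ε * n + 2090 * l := by field_simp
      linarith
    have h3 : l / n ≤ 13 * (l ^ 2 * tmix / t) := by
      rw [mul_div_assoc', div_le_div_iff₀ hn0 ht0]
      have := mul_le_mul_of_nonneg_left htn (by linarith : 0 ≤ l)
      linarith
    linarith
  · have h1 : (3 / 4 : ℝ) ^ L ≤ Real.exp (-(1 / 4)) ^ L := by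
      refine pow_le_pow_left₀ (by norm_num) ?_ L
      linarith [Real.add_one_le_exp (-(1 / 4 : ℝ))]
    have h2 : Real.exp (-(1 / 4)) ^ L ≤ Real.exp (-Real.log (24 / δ)) := by
      rw [← Real.exp_nat_mul]
      exact Real.exp_le_exp.2 (by linarith)
    rw [Real.exp_neg (Real.log _), Real.exp_log (by positivity), inv_div] at h2
    linarith

/-- The RUMEM error level dominates the standard deviation of the bucket means. -/
theorem noise_level_bounds (hK : 1 ≤ K) (hT : 2 ≤ T) (hε0 : 0 ≤ ε) {q ν : ℝ} (hq : 0 ≤ q)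
    (hν : ν = √ε + 2 * Real.log (12 * K * T ^ 3 : ℝ) * √q) :
    0 ≤ ν ∧ ε + 4 * (Real.log (K * T : ℝ) ^ 2 * q) ≤ ν ^ 2 ∧
      ν ^ 2 ≤ 392 * (ε + Real.log (K * T : ℝ) ^ 2 * q) := by
  have hl := log_two_le_log_mul hK hT
  obtain ⟨h1, h2⟩ := log_noise_bounds hK hT
  set l := Real.log (K * T : ℝ)
  set g := Real.log (12 * K * T ^ 3 : ℝ)
  have ha := Real.sqrt_nonneg ε
  have hb := Real.sqrt_nonneg q
  have ha2 := Real.sq_sqrt hε0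
  have hb2 := Real.sq_sqrt hq
  have hg0 : 0 ≤ g := by linarith
  have hg1 : l ^ 2 ≤ g ^ 2 := by gcongr
  have hg2 : g ^ 2 ≤ 49 * l ^ 2 := by nlinarith
  have e1 := mul_le_mul_of_nonneg_right hg1 hq
  have e2 := mul_le_mul_of_nonneg_right hg2 hq
  have hexp : ν ^ 2 = ε + 4 * (g ^ 2 * q) + 4 * (√ε * (g * √q)) := by
    rw [hν]
    linear_combination ha2 + 4 * g ^ 2 * hb2
  have hcross : 0 ≤ √ε * (g * √q) := by positivity
  refine ⟨by rw [hν]; positivity, by linarith, ?_⟩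
  have hamgm : 2 * (√ε * (2 * (g * √q))) ≤ ε + 4 * (g ^ 2 * q) := by
    have : ε + 4 * (g ^ 2 * q) - 2 * (√ε * (2 * (g * √q))) = (√ε - 2 * (g * √q)) ^ 2 := by
      linear_combination -ha2 - 4 * g ^ 2 * hb2
    nlinarith [sq_nonneg (√ε - 2 * (g * √q))]
  linarith

end Parameters

section Truncation

theorem IsMedianOf.le_two_mul_card {L : ℕ} {vals : ℕ → ℝ} {med b x : ℝ} (h : IsMedianOf L vals med)
    (hx : x < |med - b|) :
    L ≤ 2 * ((Finset.range L).filter fun i => x < |vals i - b|).card := by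
  rcases lt_abs.1 hx with hx | hx
  · refine h.2.trans (Nat.mul_le_mul_left 2 (Finset.card_le_card ?_))
    refine Finset.monotone_filter_right _ fun i _ hi => lt_abs.2 (Or.inl ?_)
    linarith
  · refine h.1.trans (Nat.mul_le_mul_left 2 (Finset.card_le_card ?_))
    refine Finset.monotone_filter_right _ fun i _ hi => lt_abs.2 (Or.inr ?_)
    linarith

variable {K : ℕ}

theorem sqNorm_eq_sum (v : Fin K → ℝ) : sqNorm v = ∑ i, v i ^ 2 := by
  simp [sqNorm, dotProduct, sq]

theorem sqNorm_eq_norm_sq (v : Fin K → ℝ) : sqNorm v = ‖WithLp.toLp 2 v‖ ^ 2 := by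
  simp [sqNorm_eq_sum, EuclideanSpace.norm_sq_eq]

theorem sqrt_sqNorm (v : Fin K → ℝ) : √(sqNorm v) = ‖WithLp.toLp 2 v‖ := by
  rw [sqNorm_eq_norm_sq, Real.sqrt_sq (norm_nonneg _)]

/-- A convex combination of bounded multiples of unit vectors is bounded. -/
theorem norm_weighted_features_le {m : ℕ} {π R : Fin m → ℝ} {Φ : Matrix (Fin m) (Fin K) ℝ} {r : ℝ}
    (h0 : ∀ x, 0 ≤ π x) (h1 : ∑ x, π x = 1) (hΦ : ∀ x, Φ x ⬝ᵥ Φ x ≤ 1) (hR : ∀ x, |R x| ≤ r) :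
    ‖WithLp.toLp 2 fun i => ∑ x, π x * Φ x i * R x‖ ≤ r := by
  have heq : (WithLp.toLp 2 fun i => ∑ x, π x * Φ x i * R x) =
      ∑ x, (π x * R x) • WithLp.toLp 2 (Φ x) := by
    ext i
    simp [WithLp.ofLp_sum, Finset.sum_apply, mul_right_comm]
  rw [heq]
  calc ‖∑ x, (π x * R x) • WithLp.toLp 2 (Φ x)‖ ≤ ∑ x, π x * r := by
        refine (norm_sum_le _ _).trans (Finset.sum_le_sum fun x _ => ?_)
        have hx : ‖WithLp.toLp 2 (Φ x)‖ ≤ 1 := by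
          rw [← sqrt_sqNorm]
          exact Real.sqrt_le_iff.2 ⟨zero_le_one, (hΦ x).trans_eq (one_pow 2).symm⟩
        rw [norm_smul, Real.norm_eq_abs, abs_mul, abs_of_nonneg (h0 x), mul_assoc]
        refine mul_le_mul_of_nonneg_left ?_ (h0 x)
        exact (mul_le_of_le_one_right (abs_nonneg _) hx).trans (hR x)
    _ = r := by rw [← Finset.sum_mul, h1, one_mul]

/-- Thresholding an estimate at `G + σ` turns coordinatewise deviation bounds of total level `G`
into a mean-square error bound. -/
theorem integral_sqNorm_truncated_sub_le {Ω : Type*} [MeasurableSpace Ω] {Pr : Measure Ω}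
    [IsProbabilityMeasure Pr] {raw est : Ω → Fin K → ℝ} {b : Fin K → ℝ} {G σ η δ : ℝ}
    (hη : 0 ≤ η) (hδ : 0 ≤ δ) (hG : G = √K * η) (hb : ‖WithLp.toLp 2 b‖ ≤ σ)
    (hest : ∀ ω, est ω = if G + σ < √(sqNorm (raw ω)) then 0 else raw ω)
    (htail : ∀ i, Pr {ω | η < |raw ω i - b i|} ≤ ENNReal.ofReal δ) :
    ∫ ω, sqNorm (est ω - b) ∂Pr ≤ G ^ 2 + (G + 2 * σ) ^ 2 * (K * δ) := by
  have hG0 : 0 ≤ G := by rw [hG]; positivity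
  have hσ0 : 0 ≤ σ := (norm_nonneg _).trans hb
  set bad := toMeasurable Pr (⋃ i, {ω | η < |raw ω i - b i|}) with hbad
  have hbadm : MeasurableSet bad := measurableSet_toMeasurable _ _
  have hbadle : Pr.real bad ≤ K * δ := by
    refine ENNReal.toReal_le_of_le_ofReal (by positivity) ?_
    rw [hbad, measure_toMeasurable]
    refine (measure_iUnion_fintype_le _ _).trans ((Finset.sum_le_sum fun i _ => htail i).trans ?_)
    rw [Finset.sum_const, Finset.card_univ, Fintype.card_fin, nsmul_eq_mul,
      ENNReal.ofReal_mul (Nat.cast_nonneg _), ENNReal.ofReal_natCast]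
  have hglobal : ∀ ω, sqNorm (est ω - b) ≤ (G + 2 * σ) ^ 2 := by
    intro ω
    rw [sqNorm_eq_norm_sq]
    refine pow_le_pow_left₀ (norm_nonneg _) ?_ 2
    rw [WithLp.toLp_sub]
    refine (norm_sub_le _ _).trans ?_
    have : ‖WithLp.toLp 2 (est ω)‖ ≤ G + σ := by
      rw [hest]
      split_ifs with h
      · simp only [WithLp.toLp_zero, norm_zero]
        linarith
      · rw [← sqrt_sqNorm]
        exact not_lt.1 h
    linarith
  have hgood : ∀ ω, ω ∉ bad → sqNorm (est ω - b) ≤ G ^ 2 := by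
    intro ω hω
    have hcoord : ∀ i, |raw ω i - b i| ≤ η := by
      intro i
      by_contra! hi
      exact hω (subset_toMeasurable _ _ (Set.mem_iUnion.2 ⟨i, hi⟩))
    have hraw : sqNorm (raw ω - b) ≤ G ^ 2 := by
      rw [sqNorm_eq_sum, hG, mul_pow, Real.sq_sqrt (Nat.cast_nonneg _)]
      refine (Finset.sum_le_card_nsmul _ _ (η ^ 2) fun i _ => ?_).trans_eq (by simp)
      exact sq_le_sq' (abs_le.1 (hcoord i)).1 (abs_le.1 (hcoord i)).2
    have hno : ¬ G + σ < √(sqNorm (raw ω)) := by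
      rw [not_lt, sqrt_sqNorm]
      have h1 : ‖WithLp.toLp 2 (raw ω - b)‖ ≤ G := by
        rw [← sqrt_sqNorm]
        exact Real.sqrt_le_iff.2 ⟨hG0, hraw⟩
      have h2 := norm_le_norm_sub_add (WithLp.toLp 2 (raw ω)) (WithLp.toLp 2 b)
      rw [← WithLp.toLp_sub] at h2
      linarith
    rw [hest, if_neg hno]
    exact hraw
  calc ∫ ω, sqNorm (est ω - b) ∂Pr
      ≤ ∫ ω, G ^ 2 + bad.indicator (fun _ => (G + 2 * σ) ^ 2) ω ∂Pr := by
        refine integral_mono_of_nonneg (.of_forall fun ω => ?_)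
          ((integrable_const _).add ((integrable_const _).indicator hbadm)) (.of_forall fun ω => ?_)
        · simp only [sqNorm_eq_norm_sq, Pi.zero_apply]
          positivity
        · by_cases hω : ω ∈ bad
          · simp only [Set.indicator_of_mem hω]
            nlinarith [hglobal ω]
          · simp only [Set.indicator_of_notMem hω, add_zero]
            exact hgood ω hω
    _ = G ^ 2 + (G + 2 * σ) ^ 2 * Pr.real bad := by
        rw [integral_add (integrable_const _) ((integrable_const _).indicator hbadm),
          integral_indicator_const _ hbadm]
        simp [mul_comm]
    _ ≤ _ := by gcongr

end Truncation

theorem integral_sq_eq_sq_add_integral_sub_sq {μ : Measure ℝ} [IsProbabilityMeasure μ]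
    (h1 : Integrable (fun y => y) μ) (h2 : Integrable (fun y => y ^ 2) μ) :
    ∫ y, y ^ 2 ∂μ = (∫ y, y ∂μ) ^ 2 + ∫ y, (y - ∫ z, z ∂μ) ^ 2 ∂μ := by
  set a := ∫ z, z ∂μ with ha
  have : ∀ y : ℝ, (y - a) ^ 2 = y ^ 2 - 2 * a * y + a ^ 2 := fun y => by ring
  simp_rw [this]
  have hi : Integrable (fun y => y ^ 2 - 2 * a * y) μ := h2.sub (h1.const_mul _)
  rw [integral_add hi (integrable_const _), integral_sub h2 (h1.const_mul _), integral_const_mul, ← ha]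
  simp
  ring

/-- The stationary contaminated chain and its RUMEM estimates concentrate coordinatewise. -/
theorem measure_rumem_error_le {Ω : Type*} [MeasurableSpace Ω] {Pr : Measure Ω}
    [IsProbabilityMeasure Pr] {m K T t : ℕ} [Nonempty (Fin m)] {P : Matrix (Fin m) (Fin m) ℝ}
    (hP : P ∈ rowStochastic ℝ (Fin m)) (hprim : ∃ k : ℕ, ∀ x y, 0 < (P ^ k) x y)
    {π : Fin m → ℝ} (h0 : ∀ x, 0 < π x) (h1 : ∑ x, π x = 1) (hπ : π ᵥ* P = π)
    {φ R : Fin m → ℝ} (hφ : ∀ x, φ x ^ 2 ≤ 1) {σ : ℝ} (hσ : 1 ≤ σ) (hR : ∀ x, |R x| ≤ σ)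
    {𝒟 : Fin m → Measure ℝ} [∀ x, IsProbabilityMeasure (𝒟 x)]
    (hi1 : ∀ x, Integrable (fun y => y) (𝒟 x)) (hi2 : ∀ x, Integrable (fun y => y ^ 2) (𝒟 x))
    (hmean : ∀ x, ∫ y, y ∂𝒟 x = R x) (hvar : ∀ x, ∫ y, (y - R x) ^ 2 ∂𝒟 x ≤ σ ^ 2)
    {ε : ℝ} (hε0 : 0 ≤ ε) (hε1 : ε ≤ 1 / 192)
    {Q : ℕ → Fin m → Measure ℝ} [∀ k x, IsProbabilityMeasure (Q k x)]
    {s : ℕ → Ω → Fin m} {r : ℕ → Ω → ℝ} (hs : ∀ k, Measurable (s k)) (hr : ∀ k, Measurable (r k))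
    (hlaw : HasMarkovRewardLaw Pr P π
      (fun k x => ENNReal.ofReal (1 - ε) • 𝒟 x + ENNReal.ofReal ε • Q k x) s r)
    (hK : 1 ≤ K) (hT : 2 ≤ T) (htT : t ≤ T)
    (hburn : 300000 * (tmixMat P π : ℝ) * Real.log (K * T : ℝ) ^ 2 ≤ t) {out : Ω → ℝ}
    (hout : ∀ ω, IsRumemOutput (tmixMat P π) (t + 1) (1 / (K * T ^ 2 : ℝ)) ε
      (fun k => φ (s k ω) * r k ω) (out ω)) :
    Pr {ω | 600 * σ * (√ε + 2 * Real.log (12 * K * T ^ 3 : ℝ) * √((tmixMat P π : ℝ) / t)) <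
        |out ω - ∑ x, π x * φ x * R x|} ≤ ENNReal.ofReal (1 / (K * T ^ 2 : ℝ)) := by
  have htmix := (tmixMat_spec hP hprim h0 h1 hπ).1
  have hT' : (2 : ℝ) ≤ T := by exact_mod_cast hT
  have hK' : (1 : ℝ) ≤ K := by exact_mod_cast hK
  set δ : ℝ := 1 / (K * T ^ 2 : ℝ) with hδ
  have hδ0 : 0 < δ := by positivity
  have hδ1 : δ ≤ 1 := by
    rw [hδ, div_le_one (by positivity)]
    nlinarith
  obtain ⟨hτ, hL, hM, hp, hvarM, hLδ⟩ :=
    rumem_parameter_bounds hK hT htT htmix hε0 hε1 hburn hδ rfl rfl rfl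
  obtain ⟨k, hk, hk'⟩ := exists_mul_le_rumemTau (tmixMat P π) (Nat.le_add_left 1 t) hδ0 hδ1
  set ν := √ε + 2 * Real.log (12 * K * T ^ 3 : ℝ) * √((tmixMat P π : ℝ) / t) with hν
  obtain ⟨hν0, hν1, -⟩ := noise_level_bounds hK hT hε0
    (by positivity : 0 ≤ (tmixMat P π : ℝ) / t) hν
  rw [mul_div_assoc'] at hν1
  set τ := rumemTau (tmixMat P π) (t + 1) δ with hτdef
  set L := rumemL (tmixMat P π) (t + 1) δ ε with hLdef
  set M := rumemn (tmixMat P π) (t + 1) δ / L with hMdef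
  set b := ∑ x, π x * φ x * R x with hb
  have hM' : (0 : ℝ) < M := by exact_mod_cast hM
  have hinvM : 1 / (M : ℝ) ≤ 7000 * ν ^ 2 := by
    have : 0 ≤ Real.log (K * T : ℝ) ^ 2 * (tmixMat P π : ℝ) / t := by positivity
    linarith
  have hνpos : 0 < ν := by
    refine hν0.lt_of_ne fun h => ?_
    have : 0 < 1 / (M : ℝ) := by positivity
    rw [← h] at hinvM
    linarith
  have hμ : ∀ k x, IsProbabilityMeasure
      (ENNReal.ofReal (1 - ε) • 𝒟 x + ENNReal.ofReal ε • Q k x) := fun k x => ⟨by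
    simp only [Measure.add_apply, Measure.smul_apply, measure_univ, smul_eq_mul, mul_one]
    rw [← ENNReal.ofReal_add (by linarith) hε0, sub_add_cancel, ENNReal.ofReal_one]⟩
  have hmom : ∀ x, ∫ u, u ^ 2 ∂𝒟 x ≤ 2 * σ ^ 2 := by
    intro x
    rw [integral_sq_eq_sq_add_integral_sub_sq (hi1 x) (hi2 x), hmean]
    have : R x ^ 2 ≤ σ ^ 2 := sq_le_sq' (abs_le.1 (hR x)).1 (abs_le.1 (hR x)).2
    linarith [hvar x]
  have hV : ∑ x, π x * φ x ^ 2 * ∫ u, u ^ 2 ∂𝒟 x ≤ 2 * σ ^ 2 := by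
    calc ∑ x, π x * φ x ^ 2 * ∫ u, u ^ 2 ∂𝒟 x ≤ ∑ x, π x * (2 * σ ^ 2) := by
          refine Finset.sum_le_sum fun x _ => ?_
          rw [mul_assoc]
          refine mul_le_mul_of_nonneg_left ?_ (h0 x).le
          exact (mul_le_of_le_one_left (integral_nonneg fun u => sq_nonneg u) (hφ x)).trans (hmom x)
      _ = 2 * σ ^ 2 := by rw [← Finset.sum_mul, h1, one_mul]
  have hx : 0 < M * (600 * σ * ν) := by positivity
  have hfail : M * (2 * σ ^ 2) / (M * (600 * σ * ν)) ^ 2 +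
      M * (ε + 2 * δ / (3 * (t + 1 : ℕ))) ≤ 1 / 6 := by
    have : M * (2 * σ ^ 2) / (M * (600 * σ * ν)) ^ 2 ≤ 1 / 24 := by
      rw [div_le_iff₀ (by positivity)]
      rw [div_le_iff₀ hM'] at hinvM
      have : M * (2 * σ ^ 2) * 1 ≤ M * (2 * σ ^ 2) * (7000 * ν ^ 2 * M) :=
        mul_le_mul_of_nonneg_left hinvM (by positivity)
      have h2 : 0 ≤ (M * (σ * ν)) ^ 2 := by positivity
      linarith
    linarith
  have htail := hlaw.measure_half_buckets_le hs hr hP (fun x => (h0 x).le) h1 hε0 (fun _ _ => rfl)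
    hτ (by positivity) (fun x => (sum_abs_pow_sub_stationary_le hP hprim h0 h1 hπ hk x).trans hk')
    hi1 hi2 (by simp_rw [hmean]; exact hb.symm) (by positivity) hV hM hx hfail hL
  refine (measure_mono fun ω hω => ?_).trans (htail.trans (ENNReal.ofReal_le_ofReal hLδ))
  refine ((hout ω).le_two_mul_card hω).trans_eq ?_
  congr 3
  ext l
  rw [subsampledBucketMean, ← mul_lt_mul_iff_right₀ hM', ← abs_of_pos hM', ← abs_mul, abs_of_pos hM',
    mul_sub, mul_div_cancel₀ _ hM'.ne']

/-- The squared error level and the contribution of the failure event are of the claimed order. -/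
theorem truncation_error_le {K T t tmix : ℕ} {ε σ ν : ℝ} (hK : 1 ≤ K) (hT : 2 ≤ T) (htT : t ≤ T)
    (ht : 0 < t) (htmix : 1 ≤ tmix) (hε : 0 ≤ ε)
    (hν : ν ^ 2 ≤ 392 * (ε + Real.log (K * T : ℝ) ^ 2 * tmix / t)) :
    (√K * (600 * σ * ν)) ^ 2 +
        (√K * (600 * σ * ν) + 2 * σ) ^ 2 * (K * (1 / (K * T ^ 2 : ℝ))) ≤
      10 ^ 9 * (ε + Real.log (K * T : ℝ) ^ 2 * tmix / t) * K * σ ^ 2 := by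
  have hK' : (1 : ℝ) ≤ K := by exact_mod_cast hK
  have hT' : (2 : ℝ) ≤ T := by exact_mod_cast hT
  have htT' : (t : ℝ) ≤ T := by exact_mod_cast htT
  have htmix' : (1 : ℝ) ≤ tmix := by exact_mod_cast htmix
  have ht0 : (0 : ℝ) < t := by exact_mod_cast ht
  have hl := log_two_le_log_mul hK hT
  have hG : (√K * (600 * σ * ν)) ^ 2 = 360000 * (K * σ ^ 2) * ν ^ 2 := by
    rw [mul_pow, Real.sq_sqrt (Nat.cast_nonneg _)]
    ring
  have hδ : (K : ℝ) * (1 / (K * T ^ 2)) = 1 / T ^ 2 := by field_simp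
  rw [hδ]
  set G := √K * (600 * σ * ν)
  set l := Real.log (K * T : ℝ)
  set E := ε + l ^ 2 * (tmix : ℝ) / t with hE
  have hδE : 1 / (T : ℝ) ^ 2 ≤ 3 * E := by
    have hq : 1 / (T : ℝ) ^ 2 ≤ 3 * (l ^ 2 * (tmix : ℝ) / t) := by
      rw [mul_div_assoc', div_le_div_iff₀ (by positivity) ht0]
      have h2 : 1 ≤ 3 * (l ^ 2 * (tmix : ℝ)) := by nlinarith
      have h3 : (t : ℝ) ≤ T ^ 2 := by nlinarith
      exact mul_le_mul h2 h3 ht0.le (by positivity)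
    linarith
  have hδ1 : 1 / (T : ℝ) ^ 2 ≤ 1 := by
    rw [div_le_one (by positivity)]
    exact one_le_pow₀ (by linarith)
  have hE0 : 0 ≤ E := by positivity
  have hsq : (G + 2 * σ) ^ 2 ≤ 2 * G ^ 2 + 8 * σ ^ 2 := by
    linarith [sq_nonneg (G - 2 * σ)]
  have hGE : G ^ 2 ≤ 141120000 * (K * σ ^ 2 * E) := by
    rw [hG]
    have := mul_le_mul_of_nonneg_left hν (by positivity : 0 ≤ K * σ ^ 2)
    linarith
  have hKσ : σ ^ 2 * E ≤ K * σ ^ 2 * E := by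
    rw [mul_assoc]
    exact le_mul_of_one_le_left (by positivity) hK'
  calc G ^ 2 + (G + 2 * σ) ^ 2 * (1 / T ^ 2)
      ≤ G ^ 2 + (2 * G ^ 2 + 8 * σ ^ 2) * (1 / T ^ 2) := by gcongr
    _ = G ^ 2 + 2 * G ^ 2 * (1 / T ^ 2) + 8 * σ ^ 2 * (1 / T ^ 2) := by ring
    _ ≤ G ^ 2 + 2 * G ^ 2 * 1 + 8 * σ ^ 2 * (3 * E) := by gcongr
    _ ≤ 10 ^ 9 * (K * σ ^ 2 * E) := by
        have : 0 ≤ K * σ ^ 2 * E := by positivity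
        linarith
    _ = _ := by ring

/-- **Adversarial perturbation bound for the Robust-TD reward estimate.**
For the stationary ergodic chain with Huber-contaminated rewards, if
`ε ≤ 1/192` and `T̄ = ⌈c₁ τ_mix log²(KT)⌉` for a sufficiently large universal
constant `c₁`, then there is a universal constant `c > 0` such that for all
`T̄ ≤ t ≤ T`, the thresholded coordinatewise-RUMEM estimate `b̂_t` satisfies
`E[‖b̂_t − b̄‖₂²] ≤ c (ε + log²(KT) τ_mix / t) K σ₁²`, where
`σ₁ = max{1, r̄, ρ}` and `b̄ = ∑_s π(s) φ(s) R(s)`. -/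
theorem robust_td_adversarial_perturbation_bound :
    ∃ c₁ C c : ℝ, 1 ≤ c₁ ∧ 1 ≤ C ∧ 0 < c ∧
    ∀ (Ω : Type) [MeasurableSpace Ω] (Pr : Measure Ω) [IsProbabilityMeasure Pr]
      (m K T : ℕ), 1 ≤ K → 2 ≤ T →
    -- ergodic transition matrix and stationary distribution
    ∀ (P : Matrix (Fin m) (Fin m) ℝ), (∀ x y, 0 ≤ P x y) → (∀ x, ∑ y, P x y = 1) →
      (∃ k : ℕ, ∀ x y, 0 < (P ^ k) x y) →
    ∀ (π : Fin m → ℝ), (∀ x, 0 < π x) → (∑ x, π x = 1) → (Matrix.vecMul π P = π) →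
    -- features: full column rank, normalized rows
    ∀ (Φ : Matrix (Fin m) (Fin K) ℝ), Function.Injective Φ.mulVec →
      (∀ x, Φ x ⬝ᵥ Φ x ≤ 1) →
    -- true reward distributions: means R with |R| ≤ r̄, variances ≤ ρ²
    ∀ (R : Fin m → ℝ) (rbar ρ : ℝ), 0 < ρ → (∀ x, |R x| ≤ rbar) →
    ∀ (𝒟 : Fin m → Measure ℝ), (∀ x, IsProbabilityMeasure (𝒟 x)) →
      (∀ x, Integrable (fun y => y) (𝒟 x)) →
      (∀ x, Integrable (fun y => y ^ 2) (𝒟 x)) →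
      (∀ x, (∫ y, y ∂𝒟 x) = R x) →
      (∀ x, (∫ y, (y - R x) ^ 2 ∂𝒟 x) ≤ ρ ^ 2) →
    -- Huber corruption of level ε ≤ 1/192 by arbitrary adversarial distributions
    ∀ (ε : ℝ), 0 ≤ ε → ε ≤ 1 / 192 →
    ∀ (Q : ℕ → Fin m → Measure ℝ), (∀ k x, IsProbabilityMeasure (Q k x)) →
    -- the stationary chain and contaminated rewards (joint law on cylinders)
    ∀ (s : ℕ → Ω → Fin m) (rtil : ℕ → Ω → ℝ),
      (∀ k, Measurable (s k)) → (∀ k, Measurable (rtil k)) →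
      (∀ (n : ℕ) (f : Fin (n + 1) → Fin m) (B : Fin (n + 1) → Set ℝ),
        (∀ k, MeasurableSet (B k)) →
        Pr {ω | ∀ k : Fin (n + 1), s k ω = f k ∧ rtil k ω ∈ B k} =
          ENNReal.ofReal (π (f 0)) *
            (∏ k : Fin n, ENNReal.ofReal (P (f k.castSucc) (f k.succ))) *
            ∏ k : Fin (n + 1),
              (ENNReal.ofReal (1 - ε) * 𝒟 (f k) (B k) +
                ENNReal.ofReal ε * Q k (f k) (B k))) →
    -- the raw coordinatewise RUMEM estimates and the thresholded estimate b̂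
    ∀ (braw bhat : ℕ → Ω → Fin K → ℝ),
      (∀ t ω i, IsRumemOutput (tmixMat P π) (t + 1) (1 / (K * T ^ 2 : ℝ)) ε
        (fun k => Φ (s k ω) i * rtil k ω) (braw t ω i)) →
      (∀ t ω, bhat t ω =
        if C * Real.sqrt K * max 1 (max rbar ρ) *
              (Real.sqrt ε +
                2 * Real.log (12 * K * T ^ 3 : ℝ) * Real.sqrt ((tmixMat P π : ℝ) / t)) +
            max 1 (max rbar ρ) < Real.sqrt (sqNorm (braw t ω))
        then 0 else braw t ω) →
      (∀ t, Measurable (bhat t)) →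
    -- the burn-in time
    ∀ (Tbar : ℕ), Tbar = ⌈c₁ * (tmixMat P π : ℝ) * (Real.log (K * T : ℝ)) ^ 2⌉₊ →
    -- conclusion: mean-square error bound on b̂_t
    ∀ t : ℕ, Tbar ≤ t → t ≤ T →
      (∫ ω, sqNorm (bhat t ω - fun i => ∑ x, π x * Φ x i * R x) ∂Pr) ≤
        c * (ε + (Real.log (K * T : ℝ)) ^ 2 * (tmixMat P π : ℝ) / t) * K *
          (max 1 (max rbar ρ)) ^ 2 := by
  refine ⟨300000, 600, 10 ^ 9, by norm_num, by norm_num, by norm_num, ?_⟩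
  intro Ω _ Pr _ m K T hK hT P hP0 hP1 hprim π h0 h1 hπ Φ _ hΦ R rbar ρ hρ hR 𝒟 h𝒟 hi1 hi2 hmean
    hvar ε hε0 hε1 Q hQ s r hs hr hlaw braw bhat hraw hhat _ Tbar hTbar t htT htT'
  have hne : Nonempty (Fin m) := by
    by_contra h
    rw [not_nonempty_iff] at h
    simp at h1
  have hP : P ∈ rowStochastic ℝ (Fin m) := mem_rowStochastic_iff_sum.2 ⟨hP0, hP1⟩
  have htmix := (tmixMat_spec hP hprim h0 h1 hπ).1
  have hburn : 300000 * (tmixMat P π : ℝ) * Real.log (K * T : ℝ) ^ 2 ≤ t := by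
    refine (Nat.le_ceil _).trans ?_
    rw [← hTbar]
    exact_mod_cast htT
  have ht0 : 0 < t := by
    have hl := log_two_le_log_mul hK hT
    have : (0 : ℝ) < t := lt_of_lt_of_le (by positivity) hburn
    exact_mod_cast this
  set σ := max 1 (max rbar ρ) with hσ
  have hσ1 : 1 ≤ σ := le_max_left _ _
  have hrσ : rbar ≤ σ := (le_max_left _ _).trans (le_max_right _ _)
  have hρσ : ρ ≤ σ := (le_max_right _ _).trans (le_max_right _ _)
  have hφ : ∀ i x, Φ x i ^ 2 ≤ 1 := fun i x => by
    refine le_trans ?_ (hΦ x)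
    have hsum := sqNorm_eq_sum (Φ x)
    rw [sqNorm] at hsum
    rw [hsum]
    exact Finset.single_le_sum (f := fun i => Φ x i ^ 2) (fun j _ => sq_nonneg _)
      (Finset.mem_univ i)
  have hlaw' : HasMarkovRewardLaw Pr P π
      (fun k x => ENNReal.ofReal (1 - ε) • 𝒟 x + ENNReal.ofReal ε • Q k x) s r := hlaw
  set ν := √ε + 2 * Real.log (12 * K * T ^ 3 : ℝ) * √((tmixMat P π : ℝ) / t) with hν
  obtain ⟨hν0, -, hν2⟩ := noise_level_bounds hK hT hε0
    (by positivity : 0 ≤ (tmixMat P π : ℝ) / t) hν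
  rw [mul_div_assoc'] at hν2
  have hmain := integral_sqNorm_truncated_sub_le (Pr := Pr) (raw := braw t) (est := bhat t)
    (η := 600 * σ * ν) (by positivity)
    (by positivity : (0 : ℝ) ≤ 1 / (K * T ^ 2)) rfl
    ((norm_weighted_features_le (fun x => (h0 x).le) h1 hΦ hR).trans hrσ)
    (fun ω => by rw [hhat t ω, show √K * (600 * σ * ν) = 600 * √K * σ * ν by ring])
    (fun i => measure_rumem_error_le hP hprim h0 h1 hπ (hφ i) hσ1 (fun x => (hR x).trans hrσ)
      hi1 hi2 hmean (fun x => (hvar x).trans (pow_le_pow_left₀ hρ.le hρσ 2)) hε0 hε1 hs hr hlaw'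
      hK hT htT' hburn fun ω => hraw t ω i)
  exact hmain.trans (truncation_error_le hK hT htT' ht0 htmix hε0 hν2)
end

section
/- (Deterministic one-step recursion for Robust-TD.) Let K ≥ 1, let A, Ā ∈ ℝ^{K×K} with operator norm ‖A‖₂ ≤ 2, let b̂, b̄, θ, θ* ∈ ℝ^K, let α > 0, β > 0, and σ ≥ ‖θ*‖₂, and suppose ⟨θ* − θ, Āθ + b̄⟩ ≥ β ‖θ − θ*‖₂². Define θ⁺ = θ + α(Aθ + b̂). Then ‖θ⁺ − θ*‖₂² ≤ (1 − αβ + 12α²) ‖θ − θ*‖₂² + 12 α² σ² + 3 α² ‖b̂‖₂² + (α/β) ‖b̂ − b̄‖₂² + 2α ⟨θ − θ*, (A − Ā)θ⟩. -/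
open Matrix RealInnerProductSpace

/-- **Deterministic one-step recursion for Robust-TD.**
Let `A, Ā ∈ ℝ^{K×K}` with `‖A‖₂ ≤ 2`, vectors `b̂, b̄, θ, θ*`, step `α > 0`, `β > 0`,
`σ ≥ ‖θ*‖₂`, and suppose `⟨θ* − θ, Āθ + b̄⟩ ≥ β‖θ − θ*‖₂²`. With
`θ⁺ = θ + α(Aθ + b̂)` one has
`‖θ⁺ − θ*‖² ≤ (1 − αβ + 12α²)‖θ − θ*‖² + 12α²σ² + 3α²‖b̂‖² + (α/β)‖b̂ − b̄‖²
  + 2α⟨θ − θ*, (A − Ā)θ⟩`. -/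
theorem robust_td_one_step_recursion
    (K : ℕ) (hK : 1 ≤ K)
    (A Abar : Matrix (Fin K) (Fin K) ℝ)
    (hA : ‖Matrix.toEuclideanCLM (𝕜 := ℝ) A‖ ≤ 2)
    (bhat bbar θ θstar : EuclideanSpace ℝ (Fin K))
    (α β σ : ℝ) (hα : 0 < α) (hβ : 0 < β) (hσ : ‖θstar‖ ≤ σ)
    (hdrift : β * ‖θ - θstar‖ ^ 2 ≤
      ⟪θstar - θ, (Matrix.toEuclideanCLM (𝕜 := ℝ) Abar) θ + bbar⟫)
    (θplus : EuclideanSpace ℝ (Fin K))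
    (hθplus : θplus = θ + α • ((Matrix.toEuclideanCLM (𝕜 := ℝ) A) θ + bhat)) :
    ‖θplus - θstar‖ ^ 2 ≤
      (1 - α * β + 12 * α ^ 2) * ‖θ - θstar‖ ^ 2 + 12 * α ^ 2 * σ ^ 2 +
        3 * α ^ 2 * ‖bhat‖ ^ 2 + (α / β) * ‖bhat - bbar‖ ^ 2 +
        2 * α * ⟪θ - θstar, (Matrix.toEuclideanCLM (𝕜 := ℝ) (A - Abar)) θ⟫ := by
  set T := Matrix.toEuclideanCLM (𝕜 := ℝ) A
  set S := Matrix.toEuclideanCLM (𝕜 := ℝ) Abar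
  set d := θ - θstar with hd
  have hsub : Matrix.toEuclideanCLM (𝕜 := ℝ) (A - Abar) θ = T θ - S θ := by
    rw [map_sub]
    rfl
  have hstep : θplus - θstar = d + α • (T θ + bhat) := by
    rw [hθplus, hd]
    abel
  have hexpand : ‖θplus - θstar‖ ^ 2 =
      ‖d‖ ^ 2 + 2 * α * ⟪d, T θ + bhat⟫ + α ^ 2 * ‖T θ + bhat‖ ^ 2 := by
    rw [hstep, norm_add_sq_real, real_inner_smul_right, norm_smul, mul_pow, Real.norm_eq_abs,
      sq_abs]
    ring
  have hdecomp : ⟪d, T θ + bhat⟫ =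
      ⟪d, T θ - S θ⟫ + ⟪d, S θ + bbar⟫ + ⟪d, bhat - bbar⟫ := by
    rw [← inner_add_right, ← inner_add_right]
    congr 1
    abel
  have hdrift' : ⟪d, S θ + bbar⟫ ≤ -(β * ‖d‖ ^ 2) := by
    rw [← neg_sub θ θstar, inner_neg_left] at hdrift
    linarith
  have hyoung : 2 * α * ⟪d, bhat - bbar⟫ ≤
      α * β * ‖d‖ ^ 2 + α / β * ‖bhat - bbar‖ ^ 2 := by
    have hsq : 0 ≤ α / β * (β * ‖d‖ - ‖bhat - bbar‖) ^ 2 := by positivity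
    have hcancel : α / β * (β * ‖d‖ - ‖bhat - bbar‖) ^ 2 = α * β * ‖d‖ ^ 2
        + α / β * ‖bhat - bbar‖ ^ 2 - 2 * α * (‖d‖ * ‖bhat - bbar‖) := by
      field_simp
      ring
    have hcs := mul_le_mul_of_nonneg_left (real_inner_le_norm d (bhat - bbar))
      (by positivity : 0 ≤ 2 * α)
    linarith
  have hnorm : ‖T θ + bhat‖ ≤ 2 * ‖d‖ + 2 * σ + ‖bhat‖ := by
    have hθ : ‖θ‖ ≤ ‖d‖ + σ := by
      have h := norm_add_le d θstar
      rw [hd, sub_add_cancel, ← hd] at h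
      linarith
    have hTθ := T.le_of_opNorm_le hA θ
    linarith [norm_add_le (T θ) bhat]
  have hnorm_sq : ‖T θ + bhat‖ ^ 2 ≤ 12 * ‖d‖ ^ 2 + 12 * σ ^ 2 + 3 * ‖bhat‖ ^ 2 := by
    have h := pow_le_pow_left₀ (norm_nonneg _) hnorm 2
    nlinarith [sq_nonneg (2 * ‖d‖ - 2 * σ), sq_nonneg (2 * ‖d‖ - ‖bhat‖),
      sq_nonneg (2 * σ - ‖bhat‖)]
  have hα_drift := mul_le_mul_of_nonneg_left hdrift' (by positivity : 0 ≤ 2 * α)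
  have hα_norm := mul_le_mul_of_nonneg_left hnorm_sq (sq_nonneg α)
  rw [hsub, hexpand, hdecomp]
  linarith
end

section
/- (Deterministic drift bound.) Let τ ≥ 1 be an integer, α > 0 with ατ ≤ 1/8, and c ≥ 0. Let θ_{t−τ}, θ_{t−τ+1}, …, θ_t ∈ ℝ^K satisfy θ_{k+1} = θ_k + α(A_k θ_k + b_k) for t−τ ≤ k ≤ t−1, where each A_k ∈ ℝ^{K×K} has operator norm ‖A_k‖₂ ≤ 2 and each b_k ∈ ℝ^K has ‖b_k‖₂ ≤ c. Then ‖θ_t − θ_{t−τ}‖₂ ≤ 8 α τ ‖θ_t‖₂ + 4 α τ c. -/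
open Matrix

/-- Forward drift of an affine recursion with small steps, measured against its starting point. -/
theorem norm_sub_le_of_affine_recursion {E : Type*} [NormedAddCommGroup E] [NormedSpace ℝ E]
    {α c : ℝ} (hα : 0 ≤ α) (hc : 0 ≤ c) {n : ℕ} (hαn : α * n ≤ 1 / 8)
    {x b : ℕ → E} {A : ℕ → E →L[ℝ] E}
    (hA : ∀ k < n, ‖A k‖ ≤ 2) (hb : ∀ k < n, ‖b k‖ ≤ c)
    (hrec : ∀ k < n, x (k + 1) = x k + α • (A k (x k) + b k)) :
    ∀ j ≤ n, ‖x j - x 0‖ ≤ 4 / 3 * (α * j) * (2 * ‖x 0‖ + c) := by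
  intro j
  induction j with
  | zero => simp
  | succ j ih =>
    intro hj
    have hjn : j < n := hj
    have hdrift := ih hjn.le
    have hαj : α * j ≤ 1 / 8 :=
      (mul_le_mul_of_nonneg_left (Nat.cast_le.mpr hjn.le) hα).trans hαn
    have hx : ‖x j‖ ≤ ‖x 0‖ + ‖x j - x 0‖ := norm_le_norm_add_norm_sub' _ _
    have hstep : ‖A j (x j) + b j‖ ≤ 2 * ‖x j‖ + c :=
      (norm_add_le _ _).trans (add_le_add ((A j).le_of_opNorm_le (hA j hjn) _) (hb j hjn))
    have hsucc : ‖x (j + 1) - x 0‖ ≤ ‖x j - x 0‖ + α * ‖A j (x j) + b j‖ := by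
      rw [hrec j hjn, add_sub_right_comm]
      refine (norm_add_le _ _).trans_eq ?_
      rw [norm_smul, Real.norm_of_nonneg hα]
    have hinit : 0 ≤ 2 * ‖x 0‖ + c := by positivity
    have hbound : ‖A j (x j) + b j‖ ≤ 4 / 3 * (2 * ‖x 0‖ + c) := by
      have := mul_le_mul_of_nonneg_right hαj hinit
      linarith
    have := mul_le_mul_of_nonneg_left hbound hα
    push_cast
    linarith

/-- **Deterministic drift bound.**
Let `τ ≥ 1`, `α > 0` with `ατ ≤ 1/8`, `c ≥ 0`, and let `θ_{t−τ}, …, θ_t ∈ ℝ^K`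
satisfy `θ_{k+1} = θ_k + α(A_k θ_k + b_k)` for `t−τ ≤ k ≤ t−1`, where each `A_k`
has operator norm `‖A_k‖₂ ≤ 2` and each `b_k` has `‖b_k‖₂ ≤ c`. Then
`‖θ_t − θ_{t−τ}‖₂ ≤ 8ατ‖θ_t‖₂ + 4ατc`. -/
theorem deterministic_drift_bound
    (K : ℕ) (τ : ℕ) (hτ : 1 ≤ τ) (α : ℝ) (hα : 0 < α) (hατ : α * τ ≤ 1 / 8)
    (c : ℝ) (hc : 0 ≤ c) (t : ℕ) (htτ : τ ≤ t)
    (θ : ℕ → EuclideanSpace ℝ (Fin K))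
    (A : ℕ → Matrix (Fin K) (Fin K) ℝ)
    (b : ℕ → EuclideanSpace ℝ (Fin K))
    (hA : ∀ k, t - τ ≤ k → k ≤ t - 1 → ‖Matrix.toEuclideanCLM (𝕜 := ℝ) (A k)‖ ≤ 2)
    (hb : ∀ k, t - τ ≤ k → k ≤ t - 1 → ‖b k‖ ≤ c)
    (hrec : ∀ k, t - τ ≤ k → k ≤ t - 1 →
      θ (k + 1) = θ k + α • ((Matrix.toEuclideanCLM (𝕜 := ℝ) (A k)) (θ k) + b k)) :
    ‖θ t - θ (t - τ)‖ ≤ 8 * α * τ * ‖θ t‖ + 4 * α * τ * c := by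
  have hdrift := norm_sub_le_of_affine_recursion (x := fun j => θ (t - τ + j))
    (b := fun j => b (t - τ + j)) (A := fun j => Matrix.toEuclideanCLM (𝕜 := ℝ) (A (t - τ + j)))
    hα.le hc hατ (fun k _ => hA _ (by omega) (by omega)) (fun k _ => hb _ (by omega) (by omega))
    (fun k _ => hrec (t - τ + k) (by omega) (by omega)) τ le_rfl
  simp only [Nat.sub_add_cancel htτ, add_zero] at hdrift
  have hstart : ‖θ (t - τ)‖ ≤ ‖θ t‖ + ‖θ t - θ (t - τ)‖ := norm_le_norm_add_norm_sub _ _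
  have hατ0 : 0 ≤ α * τ := by positivity
  have hmul := mul_le_mul_of_nonneg_left hstart hατ0
  have hsmall := mul_le_mul_of_nonneg_right hατ (norm_nonneg (θ t - θ (t - τ)))
  have hθ : 0 ≤ α * τ * ‖θ t‖ := by positivity
  have hc' : 0 ≤ α * τ * c := by positivity
  linarith
end

section
/- (Minimax lower bound for policy evaluation under Huber-contaminated rewards.) Let γ ∈ (0,1), ρ > 0, ε ∈ (0, 1/2), and T ∈ ℕ. Then for every measurable estimator V̂_T : ℝ^T → ℝ there exist two probability distributions 𝒟₁, 𝒟₂ on ℝ, each with mean R_i and variance at most ρ², and two adversarial distributions 𝒬₁, 𝒬₂ on ℝ, such that the contaminated laws coincide, (1−ε)𝒟₁ + ε𝒬₁ = (1−ε)𝒟₂ + ε𝒬₂ =: μ, and, writing V_i = R_i/(1−γ) for the value of the single-state Markov reward process with reward distribution 𝒟_i, one has max_{i∈{1,2}} ℙ_{(r₁,…,r_T) ∼ μ^{⊗T}} ( |V̂_T(r₁,…,r_T) − V_i| > ρ√ε / (8(1−γ)) ) ≥ 1/2. In particular, |V₁ − V₂| ≥ ρ√ε/(2(1−γ)), so no estimator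 based on T i.i.d. Huber-contaminated reward samples can achieve error o(ρ√ε/(1−γ)) uniformly over this class. -/
open MeasureTheory

/-- The law of the variable equal to `a` with probability `p` and to `0` otherwise. -/
noncomputable def twoPointMeasure (p a : ℝ) : Measure ℝ :=
  ENNReal.ofReal (1 - p) • Measure.dirac 0 + ENNReal.ofReal p • Measure.dirac a

lemma isProbabilityMeasure_mixture {α : Type*} [MeasurableSpace α] (μ ν : Measure α)
    [IsProbabilityMeasure μ] [IsProbabilityMeasure ν] {p : ℝ} (hp0 : 0 ≤ p) (hp1 : p ≤ 1) :
    IsProbabilityMeasure (ENNReal.ofReal (1 - p) • μ + ENNReal.ofReal p • ν) := by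
  constructor
  simp [← ENNReal.ofReal_add (sub_nonneg.2 hp1) hp0]

lemma integral_twoPointMeasure {p : ℝ} (a : ℝ) (hp0 : 0 ≤ p) (hp1 : p ≤ 1) (f : ℝ → ℝ) :
    ∫ x, f x ∂(twoPointMeasure p a) = (1 - p) * f 0 + p * f a := by
  have hint (c x : ℝ) : Integrable f (ENNReal.ofReal c • Measure.dirac x) :=
    (integrable_dirac (by simp)).smul_measure ENNReal.ofReal_ne_top
  rw [twoPointMeasure, integral_add_measure (hint _ _) (hint _ _)]
  simp [integral_smul_measure, ENNReal.toReal_ofReal hp0,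
    ENNReal.toReal_ofReal (sub_nonneg.2 hp1)]

/-- Contaminating a two-point law by its smaller atom, or that atom by a two-point law,
can produce the same mixture. -/
lemma twoPointMeasure_contamination_eq {ε : ℝ} (a : ℝ) (h0 : 0 ≤ ε) (h1 : ε ≤ 1) :
    ENNReal.ofReal (1 - ε) • twoPointMeasure ε a + ENNReal.ofReal ε • Measure.dirac 0 =
      ENNReal.ofReal (1 - ε) • Measure.dirac 0 +
        ENNReal.ofReal ε • twoPointMeasure (1 - ε) a := by
  have h2 : 0 ≤ 1 - ε := sub_nonneg.2 h1
  have hc : ENNReal.ofReal (1 - ε) * ENNReal.ofReal (1 - ε) + ENNReal.ofReal ε =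
      ENNReal.ofReal (1 - ε) + ENNReal.ofReal ε * ENNReal.ofReal ε := by
    rw [← ENNReal.ofReal_mul h2, ← ENNReal.ofReal_mul h0,
      ← ENNReal.ofReal_add (by positivity) h0, ← ENNReal.ofReal_add h2 (by positivity)]
    congr 1
    ring
  simp only [twoPointMeasure, sub_sub_cancel, smul_add, smul_smul]
  rw [add_right_comm, ← add_smul, hc, add_smul, mul_comm (ENNReal.ofReal (1 - ε)), add_assoc]

/-- Le Cam's two-point argument when both hypotheses induce the same law. -/
lemma half_le_max_measure_of_separated {Ω : Type*} [MeasurableSpace Ω] (P : Measure Ω)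
    [IsProbabilityMeasure P] (f : Ω → ℝ) {t v w : ℝ} (h : 2 * t < |v - w|) :
    (1 : ENNReal) / 2 ≤ max (P {x | t < |f x - v|}) (P {x | t < |f x - w|}) := by
  have hcover : {x | t < |f x - v|} ∪ {x | t < |f x - w|} = Set.univ := by
    refine Set.eq_univ_of_forall fun x => ?_
    by_contra hx
    simp only [Set.mem_union, Set.mem_ofPred_eq, not_or, not_lt] at hx
    have := abs_sub_le v (f x) w
    rw [abs_sub_comm v (f x)] at this
    linarith
  have hsum : 1 ≤ P {x | t < |f x - v|} + P {x | t < |f x - w|} := by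
    rw [← measure_univ (μ := P), ← hcover]
    exact measure_union_le _ _
  refine ENNReal.div_le_of_le_mul (hsum.trans ?_)
  rw [mul_two]
  exact add_le_add (le_max_left _ _) (le_max_right _ _)

/-- **Minimax lower bound for policy evaluation under Huber-contaminated rewards.**
For every `γ ∈ (0,1)`, `ρ > 0`, `ε ∈ (0,1/2)`, `T ∈ ℕ`, and every measurable
estimator `V̂_T : ℝ^T → ℝ`, there exist reward distributions `𝒟₁, 𝒟₂` (with means
`R₁, R₂` and variance at most `ρ²`) and adversarial distributions `𝒬₁, 𝒬₂` whose
contaminated mixtures coincide, `(1−ε)𝒟₁ + ε𝒬₁ = (1−ε)𝒟₂ + ε𝒬₂ =: μ`, such that,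
with `Vᵢ = Rᵢ/(1−γ)`,
`max_i ℙ_{μ^{⊗T}}( |V̂_T(r) − Vᵢ| > ρ√ε/(8(1−γ)) ) ≥ 1/2`, and moreover
`|V₁ − V₂| ≥ ρ√ε/(2(1−γ))`. -/
theorem minimax_lower_bound_huber_policy_evaluation
    (γ ρ ε : ℝ) (hγ0 : 0 < γ) (hγ1 : γ < 1) (hρ : 0 < ρ)
    (hε0 : 0 < ε) (hε : ε < 1 / 2) (T : ℕ)
    (Vhat : (Fin T → ℝ) → ℝ) (hVhat : Measurable Vhat) :
    ∃ (D₁ D₂ Q₁ Q₂ : Measure ℝ) (R₁ R₂ : ℝ),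
      IsProbabilityMeasure D₁ ∧ IsProbabilityMeasure D₂ ∧
      IsProbabilityMeasure Q₁ ∧ IsProbabilityMeasure Q₂ ∧
      (∫ x, x ∂D₁) = R₁ ∧ (∫ x, x ∂D₂) = R₂ ∧
      (∫ x, (x - R₁) ^ 2 ∂D₁) ≤ ρ ^ 2 ∧ (∫ x, (x - R₂) ^ 2 ∂D₂) ≤ ρ ^ 2 ∧
      ENNReal.ofReal (1 - ε) • D₁ + ENNReal.ofReal ε • Q₁ =
        ENNReal.ofReal (1 - ε) • D₂ + ENNReal.ofReal ε • Q₂ ∧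
      (1 : ENNReal) / 2 ≤
        max
          ((Measure.pi fun _ : Fin T => ENNReal.ofReal (1 - ε) • D₁ + ENNReal.ofReal ε • Q₁)
            {r | ρ * Real.sqrt ε / (8 * (1 - γ)) < |Vhat r - R₁ / (1 - γ)|})
          ((Measure.pi fun _ : Fin T => ENNReal.ofReal (1 - ε) • D₁ + ENNReal.ofReal ε • Q₁)
            {r | ρ * Real.sqrt ε / (8 * (1 - γ)) < |Vhat r - R₂ / (1 - γ)|}) ∧
      ρ * Real.sqrt ε / (2 * (1 - γ)) ≤ |R₁ / (1 - γ) - R₂ / (1 - γ)| := by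
  have hε1 : ε ≤ 1 := by linarith
  have hγ : 0 < 1 - γ := sub_pos.2 hγ1
  have hs : 0 < √ε := Real.sqrt_pos.2 hε0
  have hss : √ε ^ 2 = ε := Real.sq_sqrt hε0.le
  set a := ρ / √ε
  have hmean : ε * a = ρ * √ε := by
    simp only [a]
    field_simp
    exact hss.symm
  have hsecond : ε * a ^ 2 = ρ ^ 2 := by
    simp only [a, div_pow, hss]
    field_simp
  have hD : IsProbabilityMeasure (twoPointMeasure ε a) :=
    isProbabilityMeasure_mixture _ _ hε0.le hε1
  have hQ : IsProbabilityMeasure (twoPointMeasure (1 - ε) a) :=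
    isProbabilityMeasure_mixture _ _ (by linarith) (by linarith)
  have hμ := isProbabilityMeasure_mixture (twoPointMeasure ε a) (Measure.dirac 0) hε0.le hε1
  have hgap : |ρ * √ε / (1 - γ) - 0 / (1 - γ)| = ρ * √ε / (1 - γ) := by
    rw [zero_div, sub_zero, abs_of_pos (by positivity)]
  have hpos : 0 < ρ * √ε / (1 - γ) := by positivity
  refine ⟨twoPointMeasure ε a, Measure.dirac 0, Measure.dirac 0, twoPointMeasure (1 - ε) a,
    ρ * √ε, 0, hD, inferInstance, inferInstance, hQ, ?_, by simp, ?_, ?_,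
    twoPointMeasure_contamination_eq a hε0.le hε1, ?_, ?_⟩
  · rw [integral_twoPointMeasure a hε0.le hε1 fun x => x]
    linarith
  · rw [integral_twoPointMeasure a hε0.le hε1 fun x => (x - ρ * √ε) ^ 2, ← hmean]
    nlinarith [sq_nonneg (ε * a)]
  · simpa using sq_nonneg ρ
  · refine half_le_max_measure_of_separated _ Vhat ?_
    rw [hgap, mul_comm 8, ← div_div]
    linarith
  · rw [hgap, mul_comm 2, ← div_div]
    linarith
end
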